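/- arXiv:1110.4236 — 2 statements merged into one kernel-verified Lean document; each statement's English description precedes it below -/
import Mathlib

section
/- Let G be an affine reductive algebraic group over an algebraically closed field k of characteristic zero and X an affine G-variety. A point x ∈ X is stable if and only if the reduced orbit morphism ψ̂_x: G/G_X → X, gG_X ↦ g·x, is a proper morphism. -/
open scoped MatrixGroups

namespace PaperGIT

variable {k : Type} [Field k]

/-- The zero locus in affine space `k^σ` of a set of polynomials. -/
def zeroLocus {σ : Type} (I : Set (MvPolynomial σ k)) : Set (σ → k) :=
  {x | ∀ f ∈ I, MvPolynomial.eval x f = 0}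

/-- A subset of affine space is Zariski closed if it is the zero locus of a set
of polynomials. -/
def IsZClosed {σ : Type} (S : Set (σ → k)) : Prop :=
  ∃ I : Set (MvPolynomial σ k), S = zeroLocus I

/-- The Zariski closure of a subset of affine space. -/
def zClosure {σ : Type} (S : Set (σ → k)) : Set (σ → k) :=
  ⋂₀ {C | IsZClosed C ∧ S ⊆ C}

/-- A matrix viewed as a point of affine space. -/
def mat2pt {n : ℕ} (A : Matrix (Fin n) (Fin n) k) : Fin n × Fin n → k :=
  fun p => A p.1 p.2

/-- An affine algebraic group over `k`, realized (as is always possible) as a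
Zariski closed subgroup of some `GL n k`. -/
structure AlgGroup (k : Type) [Field k] where
  n : ℕ
  toSubgroup : Subgroup (GL (Fin n) k)
  closed : ∃ I : Set (MvPolynomial (Fin n × Fin n) k),
    ∀ A : GL (Fin n) k, A ∈ toSubgroup ↔
      mat2pt (A : Matrix (Fin n) (Fin n) k) ∈ zeroLocus I

/-- A one-parameter subgroup (cocharacter) of `G`: a group homomorphism
`k^× → G` whose matrix entries are Laurent polynomials in the parameter. -/
structure OnePS (G : AlgGroup k) where
  toFun : kˣ →* GL (Fin G.n) k
  mem : ∀ t : kˣ, toFun t ∈ G.toSubgroup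
  regular : ∃ p : Fin G.n × Fin G.n → MvPolynomial Bool k,
    ∀ (t : kˣ) (ij : Fin G.n × Fin G.n),
      (toFun t : Matrix (Fin G.n) (Fin G.n) k) ij.1 ij.2 =
        MvPolynomial.eval (fun b => if b then (t : k) else ((t⁻¹ : kˣ) : k)) (p ij)

/-- `GLimit lam g h` says that the morphism `t ↦ lam(t) * g * lam(t)⁻¹` of `k^×`
into `G` extends to a morphism `k → G` with value `h` at `t = 0`; i.e. that
`lam⁺g = lim_{t→0} lam(t) g lam(t)⁻¹` exists and equals `h`. -/
def GLimit {G : AlgGroup k} (lam : OnePS G) (g h : GL (Fin G.n) k) : Prop :=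
  h ∈ G.toSubgroup ∧
  ∃ q : Fin G.n × Fin G.n → Polynomial k,
    (∀ (t : kˣ) (ij : Fin G.n × Fin G.n),
      ((lam.toFun t * g * (lam.toFun t)⁻¹ : GL (Fin G.n) k) :
          Matrix (Fin G.n) (Fin G.n) k) ij.1 ij.2 = (q ij).eval (t : k)) ∧
    ∀ ij : Fin G.n × Fin G.n,
      (h : Matrix (Fin G.n) (Fin G.n) k) ij.1 ij.2 = (q ij).eval 0

/-- The R-parabolic subgroup `P(λ) = {g ∈ G : lim_{t→0} λ(t) g λ(t)⁻¹ exists}`. -/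
def Pset {G : AlgGroup k} (lam : OnePS G) : Set (GL (Fin G.n) k) :=
  {g | g ∈ G.toSubgroup ∧ ∃ h, GLimit lam g h}

/-- The R-Levi subgroup `L(λ) = {g ∈ G : lim_{t→0} λ(t) g λ(t)⁻¹ = g}`. -/
def Lset {G : AlgGroup k} (lam : OnePS G) : Set (GL (Fin G.n) k) :=
  {g | g ∈ G.toSubgroup ∧ GLimit lam g g}

/-- `L` is an R-Levi subgroup of the R-parabolic subgroup `P`, i.e. `L = L(μ)`
for some one-parameter subgroup `μ` with `P(μ) = P`. -/
def IsRLeviOf {G : AlgGroup k} (L P : Set (GL (Fin G.n) k)) : Prop :=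
  ∃ mu : OnePS G, Pset mu = P ∧ Lset mu = L

/-- `P` is an R-parabolic subgroup of `G`. -/
def IsRParabolic {G : AlgGroup k} (P : Set (GL (Fin G.n) k)) : Prop :=
  ∃ lam : OnePS G, P = Pset lam

/-- Two one-parameter subgroups are opposite if `P(λ) ∩ P(λ')` is an R-Levi
subgroup of both `P(λ)` and `P(λ')`. -/
def AreOpposite {G : AlgGroup k} (lam lam' : OnePS G) : Prop :=
  IsRLeviOf (Pset lam ∩ Pset lam') (Pset lam) ∧
  IsRLeviOf (Pset lam ∩ Pset lam') (Pset lam')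

/-- A subgroup (given as a subset) `H ⊆ G` is completely reducible in `G` if
every R-parabolic subgroup of `G` containing `H` has an R-Levi subgroup
containing `H`. -/
def CompletelyReducible (G : AlgGroup k) (H : Set (GL (Fin G.n) k)) : Prop :=
  ∀ lam : OnePS G, H ⊆ Pset lam →
    ∃ L : Set (GL (Fin G.n) k), IsRLeviOf L (Pset lam) ∧ H ⊆ L

/-- A subgroup (given as a subset) `H ⊆ G` is irreducible in `G` if it is not
contained in any proper R-parabolic subgroup of `G`. -/
def IrreducibleIn (G : AlgGroup k) (H : Set (GL (Fin G.n) k)) : Prop :=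
  ∀ lam : OnePS G, H ⊆ Pset lam → Pset lam = (G.toSubgroup : Set (GL (Fin G.n) k))

/-- The center `Z(G)` of `G`, as a subset. -/
def centerSet (G : AlgGroup k) : Set (GL (Fin G.n) k) :=
  {g | g ∈ G.toSubgroup ∧ ∀ h ∈ G.toSubgroup, g * h = h * g}

/-- The centralizer `Z_G(H)` of a subset `H` in `G`. -/
def centralizerSet (G : AlgGroup k) (H : Set (GL (Fin G.n) k)) :
    Set (GL (Fin G.n) k) :=
  {g | g ∈ G.toSubgroup ∧ ∀ h ∈ H, g * h = h * g}

/-- A subset of `GL n k` which is Zariski closed in `GL n k` (with the subspace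
topology coming from the space of matrices). -/
def ClosedInGL {n : ℕ} (S : Set (GL (Fin n) k)) : Prop :=
  ∃ I : Set (MvPolynomial (Fin n × Fin n) k),
    S = {A : GL (Fin n) k | mat2pt (A : Matrix (Fin n) (Fin n) k) ∈ zeroLocus I}

/-- Zariski connectedness (preconnectedness) of a subset of `GL n k`. -/
def IsConnSet {n : ℕ} (T : Set (GL (Fin n) k)) : Prop :=
  ∀ V W : Set (GL (Fin n) k), ClosedInGL V → ClosedInGL W →
    T ⊆ V ∪ W → T ∩ V ∩ W = ∅ → T ⊆ V ∨ T ⊆ W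

/-- The connected component of the identity of `G`. -/
def idComponent (G : AlgGroup k) : Set (GL (Fin G.n) k) :=
  ⋃₀ {C | C ⊆ (G.toSubgroup : Set (GL (Fin G.n) k)) ∧
      (1 : GL (Fin G.n) k) ∈ C ∧ IsConnSet C}

/-- A unipotent element of `GL n k`. -/
def IsUnipotentEl {n : ℕ} (A : GL (Fin n) k) : Prop :=
  ((A : Matrix (Fin n) (Fin n) k) - 1) ^ n = 0

/-- `G` is reductive: the unipotent radical of the identity component `G⁰` is
trivial, i.e. every connected normal subgroup of `G⁰` consisting of unipotent
elements is trivial. -/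
def IsReductive (G : AlgGroup k) : Prop :=
  ∀ H : Set (GL (Fin G.n) k),
    H ⊆ idComponent G → (1 : GL (Fin G.n) k) ∈ H →
    (∀ a ∈ H, ∀ b ∈ H, a * b ∈ H) → (∀ a ∈ H, a⁻¹ ∈ H) →
    (∀ g ∈ idComponent G, ∀ h ∈ H, g * h * g⁻¹ ∈ H) →
    IsConnSet H → (∀ h ∈ H, IsUnipotentEl h) →
    H = {1}

/-- A semisimple (diagonalizable) element of `GL n k`. -/
def IsSemisimpleEl {n : ℕ} (A : GL (Fin n) k) : Prop :=
  ∃ P : GL (Fin n) k,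
    ((P * A * P⁻¹ : GL (Fin n) k) : Matrix (Fin n) (Fin n) k).IsDiag

/-- A torus in `G`: a Zariski closed connected commutative subgroup all of
whose elements are semisimple. -/
def IsTorusIn (G : AlgGroup k) (T : Set (GL (Fin G.n) k)) : Prop :=
  T ⊆ (G.toSubgroup : Set (GL (Fin G.n) k)) ∧ (1 : GL (Fin G.n) k) ∈ T ∧
  (∀ a ∈ T, ∀ b ∈ T, a * b ∈ T) ∧ (∀ a ∈ T, a⁻¹ ∈ T) ∧
  ClosedInGL T ∧ IsConnSet T ∧
  (∀ a ∈ T, ∀ b ∈ T, a * b = b * a) ∧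
  (∀ a ∈ T, IsSemisimpleEl a)

/-- A maximal torus of `G`. -/
def IsMaximalTorusIn (G : AlgGroup k) (T : Set (GL (Fin G.n) k)) : Prop :=
  IsTorusIn G T ∧ ∀ T' : Set (GL (Fin G.n) k), IsTorusIn G T' → T ⊆ T' → T' = T

/-- A morphism of affine algebraic groups: a group homomorphism on the points
of `G` whose matrix entries are regular functions on `G`. -/
structure AlgGroupHom (G G' : AlgGroup k) where
  toFun : GL (Fin G.n) k → GL (Fin G'.n) k
  mem : ∀ g ∈ G.toSubgroup, toFun g ∈ G'.toSubgroup
  map_one : toFun 1 = 1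
  map_mul : ∀ g ∈ G.toSubgroup, ∀ h ∈ G.toSubgroup, toFun (g * h) = toFun g * toFun h
  regular : ∃ p : Fin G'.n × Fin G'.n → MvPolynomial ((Fin G.n × Fin G.n) ⊕ Unit) k,
    ∀ g ∈ G.toSubgroup, ∀ ij : Fin G'.n × Fin G'.n,
      (toFun g : Matrix (Fin G'.n) (Fin G'.n) k) ij.1 ij.2 =
        MvPolynomial.eval
          (Sum.elim (mat2pt (g : Matrix (Fin G.n) (Fin G.n) k))
            (fun _ => ((g⁻¹ : GL (Fin G.n) k) : Matrix (Fin G.n) (Fin G.n) k).det))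
          (p ij)

/-- Surjectivity of a morphism of algebraic groups (onto the points of `G'`). -/
def AlgGroupHom.Surj {G G' : AlgGroup k} (f : AlgGroupHom G G') : Prop :=
  ∀ g' ∈ G'.toSubgroup, ∃ g ∈ G.toSubgroup, f.toFun g = g'

/-- An affine `G`-variety: a Zariski closed subset of affine space `k^m`
together with an algebraic (polynomially defined) action of `G`. -/
structure GVariety (G : AlgGroup k) (m : ℕ) where
  carrier : Set (Fin m → k)
  closed : IsZClosed carrier
  act : GL (Fin G.n) k → (Fin m → k) → (Fin m → k)
  act_mem : ∀ g ∈ G.toSubgroup, ∀ x ∈ carrier, act g x ∈ carrier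
  act_one : ∀ x ∈ carrier, act 1 x = x
  act_mul : ∀ g ∈ G.toSubgroup, ∀ h ∈ G.toSubgroup, ∀ x ∈ carrier,
    act (g * h) x = act g (act h x)
  regular : ∃ p : Fin m → MvPolynomial ((Fin G.n × Fin G.n) ⊕ (Unit ⊕ Fin m)) k,
    ∀ g ∈ G.toSubgroup, ∀ x ∈ carrier, ∀ i : Fin m,
      act g x i =
        MvPolynomial.eval
          (Sum.elim (mat2pt (g : Matrix (Fin G.n) (Fin G.n) k))
            (Sum.elim
              (fun _ => ((g⁻¹ : GL (Fin G.n) k) : Matrix (Fin G.n) (Fin G.n) k).det)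
              x))
          (p i)

/-- `XLimit X lam x y` : the `lam`-ray through `x`, `t ↦ lam(t)·x`, extends to
a morphism `k → X` with value `y` at `0`; i.e. `lam⁺x` exists and equals `y`. -/
def XLimit {G : AlgGroup k} {m : ℕ} (X : GVariety G m) (lam : OnePS G)
    (x y : Fin m → k) : Prop :=
  y ∈ X.carrier ∧
  ∃ q : Fin m → Polynomial k,
    (∀ (t : kˣ) (i : Fin m), X.act (lam.toFun t) x i = (q i).eval (t : k)) ∧
    ∀ i : Fin m, y i = (q i).eval 0

/-- `lam ∈ Λ_x` : the limit `lam⁺x` exists. -/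
def InLambda {G : AlgGroup k} {m : ℕ} (X : GVariety G m) (x : Fin m → k)
    (lam : OnePS G) : Prop :=
  ∃ y, XLimit X lam x y

/-- `H_x = ∩_{λ ∈ Λ_x} P(λ)`. -/
def Hx {G : AlgGroup k} {m : ℕ} (X : GVariety G m) (x : Fin m → k) :
    Set (GL (Fin G.n) k) :=
  {g | g ∈ G.toSubgroup ∧ ∀ lam : OnePS G, InLambda X x lam → g ∈ Pset lam}

/-- `Λ_x` is symmetric: every `λ ∈ Λ_x` admits an opposite `λ' ∈ Λ_x`. -/
def SymmetricLambda {G : AlgGroup k} {m : ℕ} (X : GVariety G m)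
    (x : Fin m → k) : Prop :=
  ∀ lam : OnePS G, InLambda X x lam →
    ∃ lam' : OnePS G, InLambda X x lam' ∧ AreOpposite lam lam'

/-- The map `η : X → S(G)`, `x ↦ H_x`, is proper: `H_x ⊆ P(λ)` implies `λ ∈ Λ_x`. -/
def EtaProper {G : AlgGroup k} {m : ℕ} (X : GVariety G m) : Prop :=
  ∀ x ∈ X.carrier, ∀ lam : OnePS G, Hx X x ⊆ Pset lam → InLambda X x lam

/-- The `G`-orbit of `x`. -/
def orbitSet {G : AlgGroup k} {m : ℕ} (X : GVariety G m) (x : Fin m → k) :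
    Set (Fin m → k) :=
  {y | ∃ g ∈ G.toSubgroup, y = X.act g x}

/-- `x` is polystable: its `G`-orbit is Zariski closed. -/
def Polystable {G : AlgGroup k} {m : ℕ} (X : GVariety G m) (x : Fin m → k) : Prop :=
  IsZClosed (orbitSet X x)

/-- The stabilizer `G_x` of `x`, as a subset of `G`. -/
def stabSet {G : AlgGroup k} {m : ℕ} (X : GVariety G m) (x : Fin m → k) :
    Set (GL (Fin G.n) k) :=
  {g | g ∈ G.toSubgroup ∧ X.act g x = x}

/-- The center of the action, `G_X = ∩_{x ∈ X} G_x`. -/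
def actionCenter {G : AlgGroup k} {m : ℕ} (X : GVariety G m) :
    Set (GL (Fin G.n) k) :=
  {g | g ∈ G.toSubgroup ∧ ∀ x ∈ X.carrier, X.act g x = x}

/-- `x` is stable: polystable and `G_x/G_X` is finite (finitely many cosets
`g·G_X` with `g ∈ G_x`). -/
def Stable {G : AlgGroup k} {m : ℕ} (X : GVariety G m) (x : Fin m → k) : Prop :=
  Polystable X x ∧
  Set.Finite ((fun g => (fun h => g * h) '' actionCenter X) '' stabSet X x)

/-- `x` is properly stable: polystable with finite stabilizer. -/
def ProperlyStable {G : AlgGroup k} {m : ℕ} (X : GVariety G m) (x : Fin m → k) : Prop :=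
  Polystable X x ∧ (stabSet X x).Finite

/-- `x` is equicentral: polystable and `G_x = G_X`. -/
def Equicentral {G : AlgGroup k} {m : ℕ} (X : GVariety G m) (x : Fin m → k) : Prop :=
  Polystable X x ∧ stabSet X x = actionCenter X

/-- `x` is 1PS stable: polystable, and for every one-parameter subgroup `λ`
of `G` with `λ(k^×) ⊄ G_X` the limit `λ⁺x` does not exist. -/
def OnePSStable {G : AlgGroup k} {m : ℕ} (X : GVariety G m) (x : Fin m → k) : Prop :=
  Polystable X x ∧
  ∀ lam : OnePS G, ¬ (∀ t : kˣ, lam.toFun t ∈ actionCenter X) → ¬ InLambda X x lam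

/-- The weight space of weight `n ∈ ℤ` for the 1PS `lam` acting on `k^m`. -/
def weightSpace {G : AlgGroup k} {m : ℕ} (X : GVariety G m) (lam : OnePS G)
    (n : ℤ) : Set (Fin m → k) :=
  {w | ∀ t : kˣ, X.act (lam.toFun t) w = (((t ^ n : kˣ) : k)) • w}

/-- `μ(v, lam) = μ0`: decomposing `v` into nonzero weight vectors for `lam`,
the minimal occurring weight equals `μ0`. -/
def MuIs {G : AlgGroup k} {m : ℕ} (X : GVariety G m) (lam : OnePS G)
    (v : Fin m → k) (μ0 : ℤ) : Prop :=
  ∃ (s : Finset ℤ) (c : ℤ → (Fin m → k)),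
    (∀ n ∈ s, c n ∈ weightSpace X lam n ∧ c n ≠ 0) ∧
    v = ∑ n ∈ s, c n ∧ μ0 ∈ s ∧ ∀ n ∈ s, μ0 ≤ n

/-- `GL n k` itself, as an affine algebraic group. -/
def fullGL (k : Type) [Field k] (n : ℕ) : AlgGroup k where
  n := n
  toSubgroup := ⊤
  closed := ⟨∅, by intro A; simp [zeroLocus]⟩

/-- A subset `X ⊆ G^N` which is Zariski closed in `G^N`. -/
def GNClosed (G : AlgGroup k) (N : ℕ)
    (S : Set (Fin N → GL (Fin G.n) k)) : Prop :=
  ∃ I : Set (MvPolynomial (Fin N × (Fin G.n × Fin G.n)) k),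
    S = {x | (∀ i, x i ∈ G.toSubgroup) ∧
          ∀ f ∈ I, MvPolynomial.eval
            (fun p => ((x p.1 : Matrix (Fin G.n) (Fin G.n) k) p.2.1 p.2.2)) f = 0}

/-- Limits of the `lam`-ray through `x ∈ X ⊆ G^N`, for the simultaneous
conjugation action. -/
def GNLimit {G : AlgGroup k} {N : ℕ} (X : Set (Fin N → GL (Fin G.n) k))
    (lam : OnePS G) (x y : Fin N → GL (Fin G.n) k) : Prop :=
  y ∈ X ∧
  ∃ q : Fin N → Fin G.n × Fin G.n → Polynomial k,
    (∀ (t : kˣ) (i : Fin N) (ij : Fin G.n × Fin G.n),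
      ((lam.toFun t * x i * (lam.toFun t)⁻¹ : GL (Fin G.n) k) :
          Matrix (Fin G.n) (Fin G.n) k) ij.1 ij.2 = (q i ij).eval (t : k)) ∧
    ∀ (i : Fin N) (ij : Fin G.n × Fin G.n),
      (y i : Matrix (Fin G.n) (Fin G.n) k) ij.1 ij.2 = (q i ij).eval 0

/-- `lam ∈ Λ_x` for `x ∈ X ⊆ G^N`. -/
def GNInLambda {G : AlgGroup k} {N : ℕ} (X : Set (Fin N → GL (Fin G.n) k))
    (x : Fin N → GL (Fin G.n) k) (lam : OnePS G) : Prop :=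
  ∃ y, GNLimit X lam x y

/-- `H_x` for `x ∈ X ⊆ G^N`. -/
def GNHx {G : AlgGroup k} {N : ℕ} (X : Set (Fin N → GL (Fin G.n) k))
    (x : Fin N → GL (Fin G.n) k) : Set (GL (Fin G.n) k) :=
  {g | g ∈ G.toSubgroup ∧ ∀ lam : OnePS G, GNInLambda X x lam → g ∈ Pset lam}

/-- `φ_x`: the subgroup of `G` generated by the components of `x ∈ G^N`. -/
def phiSet {G : AlgGroup k} {N : ℕ} (x : Fin N → GL (Fin G.n) k) :
    Set (GL (Fin G.n) k) :=
  (Subgroup.closure (Set.range x) : Subgroup (GL (Fin G.n) k))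

/-- The orbit of `x ∈ G^N` under simultaneous conjugation. -/
def GNOrbit {G : AlgGroup k} {N : ℕ} (x : Fin N → GL (Fin G.n) k) :
    Set (Fin N → GL (Fin G.n) k) :=
  {y | ∃ g ∈ G.toSubgroup, y = fun i => g * x i * g⁻¹}

/-- Polystability of `x ∈ X ⊆ G^N`: the conjugation orbit is Zariski closed. -/
def GNPolystable (G : AlgGroup k) {N : ℕ} (x : Fin N → GL (Fin G.n) k) : Prop :=
  GNClosed G N (GNOrbit x)

/-- The stabilizer of `x ∈ G^N` under simultaneous conjugation. -/
def GNStab (G : AlgGroup k) {N : ℕ} (x : Fin N → GL (Fin G.n) k) :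
    Set (GL (Fin G.n) k) :=
  {g | g ∈ G.toSubgroup ∧ ∀ i, g * x i * g⁻¹ = x i}

/-- `G_X` for `X ⊆ G^N` with the simultaneous conjugation action. -/
def GNActionCenter (G : AlgGroup k) {N : ℕ}
    (X : Set (Fin N → GL (Fin G.n) k)) : Set (GL (Fin G.n) k) :=
  {g | g ∈ G.toSubgroup ∧ ∀ x ∈ X, ∀ i, g * x i * g⁻¹ = x i}

/-- `x ∈ X ⊆ G^N` is stable: polystable and `G_x/G_X` finite. -/
def GNStable (G : AlgGroup k) {N : ℕ} (X : Set (Fin N → GL (Fin G.n) k))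
    (x : Fin N → GL (Fin G.n) k) : Prop :=
  GNPolystable G x ∧
  Set.Finite ((fun g => (fun h => g * h) '' GNActionCenter G X) '' GNStab G x)

/-- `x ∈ X ⊆ G^N` is equicentral: polystable and `G_x = G_X`. -/
def GNEquicentral (G : AlgGroup k) {N : ℕ} (X : Set (Fin N → GL (Fin G.n) k))
    (x : Fin N → GL (Fin G.n) k) : Prop :=
  GNPolystable G x ∧ GNStab G x = GNActionCenter G X

/-- A subgroup `H ⊆ G` is isotropic: completely reducible with `Z_G(H) = Z(G)`. -/
def IsIsotropic (G : AlgGroup k) (H : Set (GL (Fin G.n) k)) : Prop :=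
  CompletelyReducible G H ∧ centralizerSet G H = centerSet G


theorem lift_point {k : Type} [Field k] [IsAlgClosed k] {σ τ : Type} [Finite σ] [Finite τ]
    (φ : MvPolynomial σ k →ₐ[k] MvPolynomial τ k) (J : Ideal (MvPolynomial τ k))
    (s : MvPolynomial σ k)
    (hint : ∀ j : τ, ∃ h : Polynomial (MvPolynomial σ k), h.leadingCoeff ∣ s ∧
      h.eval₂ (φ : MvPolynomial σ k →+* MvPolynomial τ k) (MvPolynomial.X j) ∈ J)
    (u : σ → k) (hs : MvPolynomial.eval u s ≠ 0)
    (hu : ∀ r, φ r ∈ J → MvPolynomial.eval u r = 0) :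
    ∃ v : τ → k, (∀ f ∈ J, MvPolynomial.eval v f = 0) ∧
      ∀ i, MvPolynomial.eval v (φ (MvPolynomial.X i)) = u i := by
  classical
  let R := MvPolynomial σ k
  let P := MvPolynomial τ k
  let ψ : R →+* (P ⧸ J) := (Ideal.Quotient.mk J).comp (φ : R →+* P)
  let Rs := Localization.Away s
  let Ds := Localization.Away (ψ s)
  let ψs : Rs →+* Ds := IsLocalization.Away.map Rs Ds ψ s
  have hψs : ∀ r : R, ψs (algebraMap R Rs r) = algebraMap (P ⧸ J) Ds (ψ r) := by
    intro r
    exact IsLocalization.map_eq _ _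
  let : Algebra Rs Ds := ψs.toAlgebra
  have hunit : ∃ t : Rs, algebraMap R Rs s * t = 1 :=
    (IsLocalization.Away.algebraMap_isUnit (S := Rs) s).exists_right_inv
  have hX : ∀ p : P, IsIntegral Rs (algebraMap (P ⧸ J) Ds (Ideal.Quotient.mk J p)) := by
    intro p
    induction p using MvPolynomial.induction_on with
    | C a =>
      have : algebraMap (P ⧸ J) Ds (Ideal.Quotient.mk J (MvPolynomial.C a)) =
          algebraMap Rs Ds (algebraMap R Rs (MvPolynomial.C a)) := by
        change _ = ψs _
        rw [hψs]
        congr 1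
        change _ = Ideal.Quotient.mk J (φ (MvPolynomial.C a))
        rw [MvPolynomial.algHom_C]
        rfl
      rw [this]
      exact isIntegral_algebraMap
    | add p q hp hq => rw [map_add, map_add]; exact hp.add hq
    | mul_X p j hp =>
      rw [map_mul, map_mul]
      refine hp.mul ?_
      obtain ⟨h, ⟨c, hc⟩, hJ⟩ := hint j
      set x : Ds := algebraMap (P ⧸ J) Ds (Ideal.Quotient.mk J (MvPolynomial.X j)) with hxdef
      let f : R →+* Ds := ψs.comp (algebraMap R Rs)
      have h0 : h.eval₂ f x = 0 := by
        have hf : f = ((algebraMap (P ⧸ J) Ds).comp (Ideal.Quotient.mk J)).comp (φ : R →+* P) := by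
          refine RingHom.ext fun r => ?_
          exact hψs _
        have := Polynomial.hom_eval₂ h (φ : R →+* P)
          ((algebraMap (P ⧸ J) Ds).comp (Ideal.Quotient.mk J)) (MvPolynomial.X j)
        rw [← hf] at this
        change _ = h.eval₂ f x at this
        rw [← this, RingHom.comp_apply, Ideal.Quotient.eq_zero_iff_mem.mpr hJ, map_zero]
      obtain ⟨g, hg, hg0⟩ := RingHom.isIntegralElem_leadingCoeff_mul f h x h0
      have hi : IsIntegral Rs (f h.leadingCoeff * x) := by
        refine ⟨g.map (algebraMap R Rs), hg.map _, ?_⟩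
        rw [Polynomial.eval₂_map]
        exact hg0
      obtain ⟨t, ht⟩ := hunit
      have : x = algebraMap Rs Ds (t * algebraMap R Rs c) * (f h.leadingCoeff * x) := by
        have h1 : ψs (algebraMap R Rs s * t) = 1 := by rw [ht, map_one]
        have h2 : algebraMap R Rs s = algebraMap R Rs h.leadingCoeff * algebraMap R Rs c :=
          (congrArg (algebraMap R Rs) hc).trans (map_mul _ _ _)
        rw [h2, map_mul, map_mul] at h1
        change x = ψs (t * algebraMap R Rs c) * (ψs (algebraMap R Rs h.leadingCoeff) * x)
        rw [map_mul]
        linear_combination (-x) * h1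
      rw [this]
      exact isIntegral_algebraMap.mul hi
  have : Algebra.IsIntegral Rs Ds := by
    constructor
    intro z
    obtain ⟨⟨d, ⟨_, n, rfl⟩⟩, hz⟩ := IsLocalization.surj (Submonoid.powers (ψ s)) z
    obtain ⟨p, rfl⟩ := Ideal.Quotient.mk_surjective d
    obtain ⟨t, ht⟩ := hunit
    have h1 : algebraMap (P ⧸ J) Ds (ψ s) * ψs t = 1 := by
      rw [← hψs, ← map_mul, ht, map_one]
    have : z = algebraMap (P ⧸ J) Ds (Ideal.Quotient.mk J p) * algebraMap Rs Ds (t ^ n) := by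
      change z = _ * ψs (t ^ n)
      rw [← hz, map_pow, mul_assoc]
      rw [map_pow, ← mul_pow, h1, one_pow, mul_one]
    rw [this]
    exact (hX p).mul isIntegral_algebraMap
  let ev : Rs →+* k := IsLocalization.Away.lift s (g := (MvPolynomial.eval u))
    (isUnit_iff_ne_zero.mpr hs)
  have hev : ∀ r : R, ev (algebraMap R Rs r) = MvPolynomial.eval u r := fun r =>
    IsLocalization.Away.lift_eq s _ r
  have : (RingHom.ker ev).IsPrime := RingHom.ker_isPrime ev
  obtain ⟨Q, -, hQ, hQP⟩ := Ideal.exists_ideal_over_prime_of_isIntegral (S := Ds) (RingHom.ker ev) ⊥ (by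
    intro z hz
    have hz : ψs z = 0 := hz
    obtain ⟨⟨r, ⟨_, n, rfl⟩⟩, hr⟩ := IsLocalization.surj (Submonoid.powers s) z
    have h1 : algebraMap (P ⧸ J) Ds (ψ r) = 0 := by
      rw [← hψs, ← hr, map_mul, hz, zero_mul]
    obtain ⟨⟨_, N, rfl⟩, hN⟩ := (IsLocalization.map_eq_zero_iff (Submonoid.powers (ψ s)) Ds _).1 h1
    have h2 : φ (s ^ N * r) ∈ J := by
      rw [← Ideal.Quotient.eq_zero_iff_mem]
      dsimp only at hN
      rw [← map_pow, ← map_mul] at hN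
      exact hN
    have h3 := hu _ h2
    rw [map_mul, map_pow] at h3
    have h4 := (mul_eq_zero.1 h3).resolve_left (pow_ne_zero _ hs)
    have h5 := congrArg ev hr
    rw [map_mul, hev, hev, h4] at h5
    dsimp only at h5
    rw [map_pow] at h5
    exact (mul_eq_zero.1 h5).resolve_right (pow_ne_zero _ hs))
  let Q' : Ideal P := Q.comap ((algebraMap (P ⧸ J) Ds).comp (Ideal.Quotient.mk J))
  have hQ' : Q'.IsPrime := Ideal.IsPrime.comap _
  obtain ⟨M, hM, hQM⟩ := Ideal.exists_le_maximal Q' hQ'.ne_top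
  obtain ⟨v, rfl⟩ := MvPolynomial.isMaximal_iff_eq_vanishingIdeal_singleton.1 hM
  have hv : ∀ f ∈ Q', MvPolynomial.eval v f = 0 := by
    intro f hf
    have := (MvPolynomial.mem_vanishingIdeal_singleton_iff v f).1 (hQM hf)
    simpa [MvPolynomial.aeval_eq_eval] using this
  refine ⟨v, fun f hf => hv f ?_, fun i => ?_⟩
  · change algebraMap (P ⧸ J) Ds (Ideal.Quotient.mk J f) ∈ Q
    rw [Ideal.Quotient.eq_zero_iff_mem.mpr hf, map_zero]
    exact Q.zero_mem
  · have : φ (MvPolynomial.X i - MvPolynomial.C (u i)) ∈ Q' := by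
      change algebraMap (P ⧸ J) Ds (ψ (MvPolynomial.X i - MvPolynomial.C (u i))) ∈ Q
      rw [← hψs]
      change _ ∈ Q.comap (algebraMap Rs Ds)
      rw [hQP, RingHom.mem_ker, hev]
      simp
    have := hv _ this
    rw [map_sub, map_sub, MvPolynomial.algHom_C] at this
    simpa [sub_eq_zero] using this

theorem alg_of_max {A D : Type} [CommRing A] [IsDomain A] [CommRing D] [IsDomain D] [Algebra A D]
    (hinj : Function.Injective (algebraMap A D)) [Algebra.FiniteType A D]
    (hmax : ∀ J : Ideal D, J ≠ ⊥ → ∃ a : A, a ≠ 0 ∧ algebraMap A D a ∈ J) :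
    Algebra.IsAlgebraic A D := by
  let M := nonZeroDivisors A
  let N := Algebra.algebraMapSubmonoid D M
  let K := FractionRing A
  let D' := Localization N
  have hN : N ≤ nonZeroDivisors D := by
    rintro _ ⟨a, ha, rfl⟩
    rw [mem_nonZeroDivisors_iff_ne_zero]
    intro h
    exact nonZeroDivisors.ne_zero ha (hinj (by simpa using h))
  have : IsDomain D' := IsLocalization.isDomain_localization hN
  have hfield : IsField D' := by
    refine ⟨exists_pair_ne D', mul_comm, ?_⟩
    intro z hz
    obtain ⟨⟨d, n⟩, hdn⟩ := IsLocalization.surj N z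
    dsimp only at hdn
    have hd : d ≠ 0 := by
      rintro rfl
      rw [map_zero] at hdn
      have hn : algebraMap D D' n ≠ 0 := (IsLocalization.map_units D' n).ne_zero
      exact (mul_ne_zero hz hn) hdn
    obtain ⟨a, ha, had⟩ := hmax (Ideal.span {d}) (by simpa using hd)
    obtain ⟨c, hc⟩ := Ideal.mem_span_singleton.1 had
    have hu : IsUnit (algebraMap D D' (algebraMap A D a)) :=
      IsLocalization.map_units D' (⟨_, a, mem_nonZeroDivisors_of_ne_zero ha, rfl⟩ : N)
    rw [hc, map_mul, ← hdn] at hu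
    obtain ⟨w, hw⟩ := hu.exists_right_inv
    exact ⟨algebraMap D D' n * (algebraMap D D' c) * w, by rw [← hw]; ring⟩
  let : Field D' := hfield.toField
  have : Algebra.FiniteType K D' := by
    have : IsLocalization (Submonoid.map (algebraMap A D) M) D' :=
      (inferInstance : IsLocalization N (Localization N))
    have := RingHom.finiteType_localizationPreserves (algebraMap A D) M K D'
      (RingHom.finiteType_algebraMap.2 inferInstance)
    exact this
  have : Module.Finite K D' := finite_of_finite_type_of_isJacobsonRing K D'
  have : Algebra.IsAlgebraic K D' := inferInstance
  have : Algebra.IsAlgebraic A D' := (IsFractionRing.comap_isAlgebraic_iff (A := A) (K := K) (C := D')).2 inferInstance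
  constructor
  intro y
  have := Algebra.IsAlgebraic.isAlgebraic (R := A) (algebraMap D D' y)
  exact (isAlgebraic_algebraMap_iff (IsLocalization.injective D' hN)).1 this


theorem exists_primes {R P : Type} [CommRing R] [CommRing P] [IsNoetherianRing R]
    [IsNoetherianRing P] (φ : R →+* P) (I : Ideal R) (hI : I ≠ ⊤) (hrad : I.IsRadical)
    (I' : Ideal P) (hI' : I'.comap φ = I) :
    ∃ (p : Ideal R) (f : R) (q : Ideal P), p.IsPrime ∧ f ∉ p ∧ I ≤ p ∧ (∀ a ∈ p, a * f ∈ I) ∧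
      q.IsPrime ∧ I' ≤ q ∧ q.comap φ = p ∧ ∀ J : Ideal P, q < J → ∃ r, r ∉ p ∧ φ r ∈ J := by
  have : Nontrivial (R ⧸ I) := Ideal.Quotient.nontrivial_iff.2 hI
  obtain ⟨p, hp⟩ := associatedPrimes.nonempty R (R ⧸ I)
  rw [AssociatedPrimes.mem_iff, isAssociatedPrime_iff] at hp
  obtain ⟨hp, x, hx⟩ := hp
  obtain ⟨f, rfl⟩ := Ideal.Quotient.mk_surjective x
  have hmem : ∀ a, a ∈ p ↔ a * f ∈ I := by
    intro a
    rw [hx, Submodule.mem_colon_singleton, Submodule.mem_bot, ← Ideal.Quotient.eq_zero_iff_mem,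
      map_mul]
    rfl
  have hIp : I ≤ p := fun a ha => (hmem a).2 (I.mul_mem_right _ ha)
  have hf : f ∉ p := by
    intro h
    have h2 := (hmem f).1 h
    have h3 : f ∈ I := hrad ⟨2, by rwa [pow_two]⟩
    exact hp.ne_top ((Ideal.eq_top_iff_one _).2 ((hmem 1).2 (by simpa using h3)))
  let S : Submonoid P := p.primeCompl.map φ
  have hdis : Disjoint (I' : Set P) S := by
    rw [Set.disjoint_left]
    rintro _ h1 ⟨r, hr, rfl⟩
    refine hr (hIp ?_)
    rw [← hI']
    exact h1
  obtain ⟨q, ⟨hq1, hq2⟩, hqmax⟩ := set_has_maximal_iff_noetherian.2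
    (inferInstance : IsNoetherian P P) {q : Ideal P | I' ≤ q ∧ Disjoint (q : Set P) S} ⟨I', le_rfl, hdis⟩
  have hqm : ∀ J : Ideal P, q < J → ¬ Disjoint (J : Set P) S := fun J hJ hd =>
    hqmax J ⟨hq1.trans hJ.le, hd⟩ hJ
  have hqp := Ideal.isPrime_of_maximally_disjoint q S hq2 hqm
  have hle : ∀ r, φ r ∈ q → r ∈ p := by
    intro r hr
    by_contra h
    exact Set.disjoint_left.1 hq2 hr ⟨r, h, rfl⟩
  refine ⟨p, f, q, hp, hf, hIp, fun a ha => (hmem a).1 ha, hqp, hq1, ?_, ?_⟩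
  · refine le_antisymm hle ?_
    intro r hr
    have h1 : φ r * φ f ∈ q := by
      rw [← map_mul]
      apply hq1
      have := (hmem r).1 hr
      rw [← hI'] at this
      exact this
    exact (hqp.mem_or_mem h1).resolve_right fun h => hf (hle f h)
  · intro J hJ
    obtain ⟨_, h1, ⟨r, hr, rfl⟩⟩ := Set.not_disjoint_iff.1 (hqm J hJ)
    exact ⟨r, hr, h1⟩

theorem exists_alg_rel {k : Type} [Field k] {σ τ : Type} [Finite σ] [Finite τ]
    (φ : MvPolynomial σ k →ₐ[k] MvPolynomial τ k)
    (p : Ideal (MvPolynomial σ k)) (q : Ideal (MvPolynomial τ k)) (hp : p.IsPrime) (hq : q.IsPrime)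
    (hpq : q.comap (φ : MvPolynomial σ k →+* MvPolynomial τ k) = p)
    (hmax : ∀ J : Ideal (MvPolynomial τ k), q < J → ∃ r, r ∉ p ∧ φ r ∈ J)
    (y : MvPolynomial τ k) :
    ∃ h : Polynomial (MvPolynomial σ k), h.leadingCoeff ∉ p ∧
      h.eval₂ (φ : MvPolynomial σ k →+* MvPolynomial τ k) y ∈ q := by
  let A := MvPolynomial σ k ⧸ p
  let D := MvPolynomial τ k ⧸ q
  let ι : A →ₐ[k] D := Ideal.quotientMapₐ q φ (fun r hr => by rw [← hpq] at hr; exact hr)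
  have hι : ∀ r, ι (Ideal.Quotient.mk p r) = Ideal.Quotient.mk q (φ r) := fun r => rfl
  let _ : Algebra A D := ι.toRingHom.toAlgebra
  have : IsScalarTower k A D := IsScalarTower.of_algebraMap_eq fun x => (ι.commutes x).symm
  have : Algebra.FiniteType A D := Algebra.FiniteType.of_restrictScalars_finiteType k A D
  have hinj : Function.Injective (algebraMap A D) := by
    rw [injective_iff_map_eq_zero]
    intro a ha
    obtain ⟨r, rfl⟩ := Ideal.Quotient.mk_surjective a
    have ha : Ideal.Quotient.mk q (φ r) = 0 := ha
    rw [Ideal.Quotient.eq_zero_iff_mem] at ha ⊢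
    rw [← hpq]
    exact ha
  have halg : Algebra.IsAlgebraic A D := by
    apply alg_of_max hinj
    intro J hJ
    have hlt : q < J.comap (Ideal.Quotient.mk q) := by
      refine lt_of_le_of_ne ?_ ?_
      · intro z hz
        rw [Ideal.mem_comap, Ideal.Quotient.eq_zero_iff_mem.2 hz]
        exact J.zero_mem
      · intro h
        apply hJ
        rw [eq_bot_iff]
        intro z hz
        obtain ⟨z, rfl⟩ := Ideal.Quotient.mk_surjective z
        rw [Ideal.mem_bot, Ideal.Quotient.eq_zero_iff_mem, h]
        exact hz
    obtain ⟨r, hr, hrJ⟩ := hmax _ hlt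
    exact ⟨Ideal.Quotient.mk p r, fun h => hr (Ideal.Quotient.eq_zero_iff_mem.1 h), hrJ⟩
  obtain ⟨g, hg, hg0⟩ := halg.isAlgebraic (Ideal.Quotient.mk q y)
  obtain ⟨h, hh, hdeg⟩ := Polynomial.exists_degree_eq_of_mem_lifts (f := Ideal.Quotient.mk p) (p := g)
    (Polynomial.map_surjective _ Ideal.Quotient.mk_surjective g |> fun ⟨h, hh⟩ => ⟨h, hh⟩)
  refine ⟨h, ?_, ?_⟩
  · intro hl
    apply hg
    rw [← Polynomial.leadingCoeff_eq_zero, Polynomial.leadingCoeff,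
      ← Polynomial.natDegree_eq_of_degree_eq hdeg, ← hh, Polynomial.coeff_map]
    exact Ideal.Quotient.eq_zero_iff_mem.2 hl
  · rw [← Ideal.Quotient.eq_zero_iff_mem, Polynomial.hom_eval₂]
    rw [← hh, Polynomial.aeval_def, Polynomial.eval₂_map] at hg0
    exact hg0

theorem generic_sep {k : Type} [Field k] [IsAlgClosed k] {σ τ : Type} [Finite σ] [Finite τ]
    (Γ : Set (τ → k)) (hne : Γ.Nonempty)
    (hΓ : ∀ v, v ∉ Γ → ∃ f : MvPolynomial τ k, (∀ w ∈ Γ, MvPolynomial.eval w f = 0) ∧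
      MvPolynomial.eval v f ≠ 0)
    (θ : σ → MvPolynomial τ k) (Θ : (τ → k) → (σ → k))
    (hΘ : ∀ v i, Θ v i = MvPolynomial.eval v (θ i)) :
    ∃ e : MvPolynomial σ k, (∃ v ∈ Γ, MvPolynomial.eval (Θ v) e ≠ 0) ∧
      ∀ (ρ : Type) [Finite ρ] (C : Set ((τ → k) × (ρ → k))),
        (∀ v a, (v, a) ∉ C → ∃ f : MvPolynomial (τ ⊕ ρ) k,
          (∀ w b, (w, b) ∈ C → MvPolynomial.eval (Sum.elim w b) f = 0) ∧
          MvPolynomial.eval (Sum.elim v a) f ≠ 0) →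
        (∀ v a v', (v, a) ∈ C → v' ∈ Γ → Θ v = Θ v' → (v', a) ∈ C) →
        (∀ v a, (v, a) ∈ C → v ∈ Γ) →
        ∀ v a, v ∈ Γ → MvPolynomial.eval (Θ v) e ≠ 0 → (v, a) ∉ C →
          ∃ w : MvPolynomial (σ ⊕ ρ) k,
            (∀ v' b, (v', b) ∈ C → MvPolynomial.eval (Sum.elim (Θ v') b) w = 0) ∧
            MvPolynomial.eval (Sum.elim (Θ v) a) w ≠ 0 := by
  classical
  let φ : MvPolynomial σ k →ₐ[k] MvPolynomial τ k := MvPolynomial.aeval θ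
  have hφ : ∀ v r, MvPolynomial.eval v (φ r) = MvPolynomial.eval (Θ v) r := by
    intro v r
    induction r using MvPolynomial.induction_on with
    | C a => simp [φ]
    | add p q hp hq => rw [map_add, map_add, map_add, hp, hq]
    | mul_X p i hp => rw [map_mul, map_mul, map_mul, hp]; simp [φ, hΘ]
  let I : Ideal (MvPolynomial σ k) := MvPolynomial.vanishingIdeal k (Θ '' Γ)
  let I' : Ideal (MvPolynomial τ k) := MvPolynomial.vanishingIdeal k Γ
  have hImem : ∀ r, r ∈ I ↔ ∀ v ∈ Γ, MvPolynomial.eval (Θ v) r = 0 := by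
    intro r
    simp [I, MvPolynomial.mem_vanishingIdeal_iff, MvPolynomial.aeval_eq_eval]
  have hI'mem : ∀ r, r ∈ I' ↔ ∀ v ∈ Γ, MvPolynomial.eval v r = 0 := by
    intro r
    simp [I', MvPolynomial.mem_vanishingIdeal_iff, MvPolynomial.aeval_eq_eval]
  obtain ⟨p, f, q, hp, hf, hIp, hpf, hq, hI'q, hqp, hmax⟩ :=
    exists_primes (φ : MvPolynomial σ k →+* MvPolynomial τ k) I
    (by
      intro h
      obtain ⟨v, hv⟩ := hne
      have := (hImem 1).1 (h ▸ Submodule.mem_top) v hv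
      simp at this)
    (by
      rintro r ⟨n, hn⟩
      rw [hImem] at hn ⊢
      intro v hv
      have := hn v hv
      rw [map_pow] at this
      exact (pow_eq_zero_iff (by rintro rfl; simp at this)).1 this)
    I'
    (by
      ext r
      rw [Ideal.mem_comap, hI'mem, hImem]
      exact forall₂_congr fun v _ => by rw [← hφ]; rfl)
  have hrel : ∀ j : τ, ∃ h : Polynomial (MvPolynomial σ k), h.leadingCoeff ∉ p ∧
      h.eval₂ (φ : MvPolynomial σ k →+* MvPolynomial τ k) (MvPolynomial.X j) ∈ q :=
    fun j => exists_alg_rel φ p q hp hq hqp hmax _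
  choose h hlc hh using hrel
  have := Fintype.ofFinite τ
  let s : MvPolynomial σ k := ∏ j, (h j).leadingCoeff
  have hs : s ∉ p := fun hs => by
    obtain ⟨j, -, hj⟩ := (hp.prod_mem_iff).1 hs
    exact hlc j hj
  have hdvd : ∀ j, (h j).leadingCoeff ∣ s := fun j => Finset.dvd_prod_of_mem _ (Finset.mem_univ j)
  have hqΓ : ∀ v, (∀ g ∈ q, MvPolynomial.eval v g = 0) → v ∈ Γ := by
    intro v hv
    by_contra hv'
    obtain ⟨g, hg, hg'⟩ := hΓ v hv'
    exact hg' (hv g (hI'q ((hI'mem g).2 hg)))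
  refine ⟨s * f, ?_, ?_⟩
  · by_contra! hcon
    have : s * f ∈ p := hIp ((hImem _).2 hcon)
    exact (hp.mem_or_mem this).elim hs hf
  intro ρ _ C hC hsat hCΓ v a hv he hva
  have hsurj : ∀ v ∈ Γ, MvPolynomial.eval (Θ v) (s * f) ≠ 0 →
      ∃ v', (∀ g ∈ q, MvPolynomial.eval v' g = 0) ∧ Θ v' = Θ v := by
    intro v hv he
    rw [map_mul] at he
    obtain ⟨v', h1, h2⟩ := lift_point φ q s (fun j => ⟨h j, hdvd j, hh j⟩) (Θ v)
      (left_ne_zero_of_mul he) (by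
        intro r hr
        have hr : r ∈ p := by rw [← hqp]; exact hr
        have := (hImem _).1 (hpf r hr) v hv
        rw [map_mul] at this
        exact (mul_eq_zero.1 this).resolve_right (right_ne_zero_of_mul he))
    refine ⟨v', h1, ?_⟩
    ext i
    rw [← h2 i, hφ, MvPolynomial.eval_X]
  let φ' : MvPolynomial (σ ⊕ ρ) k →ₐ[k] MvPolynomial (τ ⊕ ρ) k :=
    MvPolynomial.aeval (Sum.elim (fun i => MvPolynomial.rename Sum.inl (θ i))
      (fun j => MvPolynomial.X (Sum.inr j)))
  have hφ' : ∀ v b r, MvPolynomial.eval (Sum.elim v b) (φ' r) =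
      MvPolynomial.eval (Sum.elim (Θ v) b) r := by
    intro v b r
    induction r using MvPolynomial.induction_on with
    | C a => simp [φ']
    | add p q hp hq => rw [map_add, map_add, map_add, hp, hq]
    | mul_X p i hp =>
      rw [map_mul, map_mul, map_mul, hp]
      rcases i with i | i
      · simp [φ', hΘ, MvPolynomial.eval_rename]
      · simp [φ']
  have hφ'' : ∀ r, φ' (MvPolynomial.rename Sum.inl r) = MvPolynomial.rename Sum.inl (φ r) := by
    intro r
    induction r using MvPolynomial.induction_on with
    | C a => simp [φ', φ]
    | add p q hp hq => simp only [map_add, hp, hq]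
    | mul_X p i hp => simp only [map_mul, hp]; simp [φ', φ]
  let CV : Set ((τ ⊕ ρ) → k) := {z | (z ∘ Sum.inl, z ∘ Sum.inr) ∈ C ∧
    ∀ g ∈ q, MvPolynomial.eval (z ∘ Sum.inl) g = 0}
  let J : Ideal (MvPolynomial (τ ⊕ ρ) k) := MvPolynomial.vanishingIdeal k CV
  have hJ : ∀ r, r ∈ J ↔ ∀ z ∈ CV, MvPolynomial.eval z r = 0 := by
    intro r
    simp [J, MvPolynomial.mem_vanishingIdeal_iff, MvPolynomial.aeval_eq_eval]
  have key : ∃ w, φ' w ∈ J ∧ MvPolynomial.eval (Sum.elim (Θ v) a) w ≠ 0 := by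
    by_contra! hcon
    obtain ⟨z, hz, hz'⟩ := lift_point φ' J (MvPolynomial.rename Sum.inl s) (by
      rintro (j | j)
      · refine ⟨(h j).map (MvPolynomial.rename Sum.inl :
          MvPolynomial σ k →ₐ[k] MvPolynomial (σ ⊕ ρ) k).toRingHom, ?_, ?_⟩
        · rw [Polynomial.leadingCoeff_map_of_injective
            (MvPolynomial.rename_injective _ Sum.inl_injective)]
          exact map_dvd _ (hdvd j)
        · have e1 : Polynomial.eval₂ (φ' : MvPolynomial (σ ⊕ ρ) k →+* MvPolynomial (τ ⊕ ρ) k)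
              (MvPolynomial.X (Sum.inl j)) ((h j).map (MvPolynomial.rename Sum.inl :
                MvPolynomial σ k →ₐ[k] MvPolynomial (σ ⊕ ρ) k).toRingHom) =
              MvPolynomial.rename Sum.inl ((h j).eval₂
                (φ : MvPolynomial σ k →+* MvPolynomial τ k) (MvPolynomial.X j)) := by
            rw [Polynomial.eval₂_map]
            have := Polynomial.hom_eval₂ (h j) (φ : MvPolynomial σ k →+* MvPolynomial τ k)
              (MvPolynomial.rename Sum.inl :
                MvPolynomial τ k →ₐ[k] MvPolynomial (τ ⊕ ρ) k).toRingHom (MvPolynomial.X j)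
            refine Eq.trans ?_ this.symm
            congr 1
            · exact RingHom.ext fun r => hφ'' r
            · exact (MvPolynomial.rename_X _ _).symm
          rw [e1, hJ]
          intro z hz
          rw [MvPolynomial.eval_rename]
          exact hz.2 _ (hh j)
      · refine ⟨Polynomial.X - Polynomial.C (MvPolynomial.X (Sum.inr j)), ?_, ?_⟩
        · rw [Polynomial.leadingCoeff_X_sub_C]
          exact one_dvd _
        · simp [φ'])
      (Sum.elim (Θ v) a) (by
        rw [MvPolynomial.eval_rename, Sum.elim_comp_inl]
        rw [map_mul] at he
        exact left_ne_zero_of_mul he) hcon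
    have ez : z = Sum.elim (z ∘ Sum.inl) (z ∘ Sum.inr) := (Sum.elim_comp_inl_inr z).symm
    have hinr : z ∘ Sum.inr = a := by
      ext j
      have := hz' (Sum.inr j)
      simpa [φ'] using this
    have hinl : Θ (z ∘ Sum.inl) = Θ v := by
      ext i
      have := hz' (Sum.inl i)
      rw [ez, hφ'] at this
      simpa using this
    have hzC : (z ∘ Sum.inl, z ∘ Sum.inr) ∈ C := by
      by_contra hz0
      obtain ⟨g, hg, hg'⟩ := hC _ _ hz0
      apply hg'
      rw [← ez]
      apply hz
      rw [hJ]
      intro z1 hz1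
      have := hg _ _ hz1.1
      rwa [Sum.elim_comp_inl_inr] at this
    rw [hinr] at hzC
    exact hva (hsat _ _ _ hzC hv hinl)
  obtain ⟨w, hwJ, hw⟩ := key
  refine ⟨w * MvPolynomial.rename Sum.inl (s * f), ?_, ?_⟩
  · intro v' b hb
    rw [map_mul, MvPolynomial.eval_rename, Sum.elim_comp_inl]
    by_cases he' : MvPolynomial.eval (Θ v') (s * f) = 0
    · rw [he', mul_zero]
    · obtain ⟨v2, hv2, hv2'⟩ := hsurj v' (hCΓ _ _ hb) he'
      have hv2C : (v2, b) ∈ C := hsat _ _ _ hb (hqΓ _ hv2) hv2'.symm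
      have := (hJ _).1 hwJ (Sum.elim v2 b) ⟨by simpa using hv2C, by simpa using hv2⟩
      rw [hφ', hv2'] at this
      rw [this, zero_mul]
  · rw [map_mul, MvPolynomial.eval_rename, Sum.elim_comp_inl]
    exact mul_ne_zero hw he

/-- The embedding of `GL n` as a closed subset of affine space. -/
def emb {k : Type} [Field k] {n : ℕ} (g : GL (Fin n) k) : (Fin n × Fin n) ⊕ Unit → k :=
  Sum.elim (mat2pt (g : Matrix (Fin n) (Fin n) k))
    (fun _ => ((g⁻¹ : GL (Fin n) k) : Matrix (Fin n) (Fin n) k).det)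

theorem mat2pt_inj {k : Type} [Field k] {n : ℕ} {g h : GL (Fin n) k}
    (H : mat2pt (g : Matrix (Fin n) (Fin n) k) = mat2pt (h : Matrix (Fin n) (Fin n) k)) : g = h := by
  apply Units.ext
  ext i j
  exact congrFun H (i, j)

theorem emb_inj {k : Type} [Field k] {n : ℕ} {g h : GL (Fin n) k} (H : emb g = emb h) : g = h := by
  apply mat2pt_inj
  have := congrArg (fun z => z ∘ Sum.inl) H
  simpa [emb] using this

theorem emb_sep {k : Type} [Field k] (G : AlgGroup k) (v : (Fin G.n × Fin G.n) ⊕ Unit → k)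
    (hv : v ∉ emb '' (G.toSubgroup : Set (GL (Fin G.n) k))) :
    ∃ f : MvPolynomial ((Fin G.n × Fin G.n) ⊕ Unit) k,
      (∀ w ∈ emb '' (G.toSubgroup : Set (GL (Fin G.n) k)), MvPolynomial.eval w f = 0) ∧
      MvPolynomial.eval v f ≠ 0 := by
  obtain ⟨I, hI⟩ := G.closed
  by_cases h1 : ∃ f ∈ I, MvPolynomial.eval (v ∘ Sum.inl) f ≠ 0
  · obtain ⟨f, hf, hfv⟩ := h1
    refine ⟨MvPolynomial.rename Sum.inl f, ?_, by rwa [MvPolynomial.eval_rename]⟩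
    rintro _ ⟨g, hg, rfl⟩
    rw [MvPolynomial.eval_rename, emb, Sum.elim_comp_inl]
    exact (hI g).1 hg f hf
  · push Not at h1
    let M : Matrix (Fin G.n) (Fin G.n) (MvPolynomial ((Fin G.n × Fin G.n) ⊕ Unit) k) :=
      Matrix.of fun i j => MvPolynomial.X (Sum.inl (i, j))
    have hM : ∀ w, MvPolynomial.eval w (M.det * MvPolynomial.X (Sum.inr ()) - 1) =
        (Matrix.of fun i j => w (Sum.inl (i, j))).det * w (Sum.inr ()) - 1 := by
      intro w
      rw [map_sub, map_mul, RingHom.map_det, MvPolynomial.eval_X, map_one]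
      congr 3
      ext i j
      simp [M]
    refine ⟨M.det * MvPolynomial.X (Sum.inr ()) - 1, ?_, ?_⟩
    · rintro _ ⟨g, hg, rfl⟩
      rw [hM]
      change (g : Matrix (Fin G.n) (Fin G.n) k).det *
        ((g⁻¹ : GL (Fin G.n) k) : Matrix (Fin G.n) (Fin G.n) k).det - 1 = 0
      rw [← Matrix.det_mul, ← Units.val_mul, mul_inv_cancel]
      simp
    · rw [hM]
      intro h0
      apply hv
      rw [sub_eq_zero] at h0
      set N : Matrix (Fin G.n) (Fin G.n) k := Matrix.of fun i j => v (Sum.inl (i, j)) with hN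
      have hu : IsUnit N.det := IsUnit.of_mul_eq_one _ h0
      let g : GL (Fin G.n) k := Matrix.GeneralLinearGroup.mk'' N hu
      have hgN : (g : Matrix (Fin G.n) (Fin G.n) k) = N := rfl
      refine ⟨g, (hI g).2 h1, ?_⟩
      have h3 : N.det * ((g⁻¹ : GL (Fin G.n) k) : Matrix (Fin G.n) (Fin G.n) k).det = 1 := by
        rw [← hgN, ← Matrix.det_mul, ← Units.val_mul, mul_inv_cancel]
        simp
      ext (⟨i, j⟩ | ⟨⟩)
      · rfl
      · change ((g⁻¹ : GL (Fin G.n) k) : Matrix (Fin G.n) (Fin G.n) k).det = _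
        exact hu.mul_left_cancel (h3.trans h0.symm)

theorem eval_aeval' {k : Type} [Field k] {σ τ : Type} (z : τ → k) (c : σ → MvPolynomial τ k)
    (f : MvPolynomial σ k) :
    MvPolynomial.eval z (MvPolynomial.aeval c f) =
      MvPolynomial.eval (fun i => MvPolynomial.eval z (c i)) f := by
  induction f using MvPolynomial.induction_on with
  | C a => simp
  | add p q hp hq => simp only [map_add, hp, hq]
  | mul_X p i hp => simp only [map_mul, hp]; simp

section
variable {G Ghat : AlgGroup k} {m : ℕ} (X : GVariety G m)
    (pi : AlgGroupHom G Ghat)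
    (hker : ∀ g ∈ G.toSubgroup, (pi.toFun g = 1 ↔ g ∈ actionCenter X))
    (x : Fin m → k)

theorem cosets_finite_iff
    (hker : ∀ g ∈ G.toSubgroup, (pi.toFun g = 1 ↔ g ∈ actionCenter X)) :
    Set.Finite ((fun g => (fun h => g * h) '' actionCenter X) '' stabSet X x) ↔
      (pi.toFun '' stabSet X x).Finite := by
  classical
  have hone : (1 : GL (Fin G.n) k) ∈ actionCenter X := ⟨one_mem _, fun y hy => X.act_one y hy⟩
  constructor
  · intro hfin
    let Φ : Set (GL (Fin G.n) k) → GL (Fin Ghat.n) k := fun T =>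
      if h : T.Nonempty then pi.toFun h.some else 1
    refine (hfin.image Φ).subset ?_
    rintro _ ⟨g, hg, rfl⟩
    refine ⟨_, ⟨g, hg, rfl⟩, ?_⟩
    have hne : ((fun h => g * h) '' actionCenter X).Nonempty := ⟨_, 1, hone, rfl⟩
    simp only [Φ]
    rw [dif_pos hne]
    obtain ⟨c, hc, hc'⟩ := hne.some_mem
    rw [← hc', pi.map_mul g hg.1 c hc.1, (hker c hc.1).2 hc, mul_one]
  · intro hfin
    let Ψ : GL (Fin Ghat.n) k → Set (GL (Fin G.n) k) := fun s =>
      {g | g ∈ G.toSubgroup ∧ pi.toFun g = s}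
    refine (hfin.image Ψ).subset ?_
    rintro _ ⟨g, hg, rfl⟩
    refine ⟨_, ⟨g, hg, rfl⟩, ?_⟩
    ext g'
    constructor
    · rintro ⟨h1, h2⟩
      refine ⟨g⁻¹ * g', (hker _ (mul_mem (inv_mem hg.1) h1)).1 ?_, by simp⟩
      rw [pi.map_mul _ (inv_mem hg.1) _ h1, h2, ← pi.map_mul _ (inv_mem hg.1) _ hg.1,
        inv_mul_cancel, pi.map_one]
    · rintro ⟨c, hc, rfl⟩
      refine ⟨mul_mem hg.1 hc.1, ?_⟩
      simp only
      rw [pi.map_mul g hg.1 c hc.1, (hker c hc.1).2 hc, mul_one]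

end

theorem proper_imp_stable
    {k : Type} [Field k]
    (G Ghat : AlgGroup k)
    {m : ℕ} (X : GVariety G m)
    (pi : AlgGroupHom G Ghat) (hsurj : pi.Surj)
    (hker : ∀ g ∈ G.toSubgroup, (pi.toFun g = 1 ↔ g ∈ actionCenter X))
    (x : Fin m → k) (hx : x ∈ X.carrier)
    (F : GL (Fin Ghat.n) k → (Fin m → k))
    (hF : ∀ g ∈ G.toSubgroup, F (pi.toFun g) = X.act g x)
    (H : ∀ (q : ℕ) (C : Set (GL (Fin Ghat.n) k × (Fin q → k))),
        (∃ I : Set (MvPolynomial ((Fin Ghat.n × Fin Ghat.n) ⊕ Fin q) k),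
          C = {p | p.1 ∈ Ghat.toSubgroup ∧
                Sum.elim (mat2pt (p.1 : Matrix (Fin Ghat.n) (Fin Ghat.n) k)) p.2 ∈
                  zeroLocus I}) →
        ∃ J : Set (MvPolynomial (Fin m ⊕ Fin q) k),
          {y : (Fin m → k) × (Fin q → k) | ∃ p ∈ C, y = (F p.1, p.2)} =
            {y : (Fin m → k) × (Fin q → k) |
              y.1 ∈ X.carrier ∧ Sum.elim y.1 y.2 ∈ zeroLocus J}) : Stable X x := by
  classical
  constructor
  · obtain ⟨J, hJ⟩ := H 0 _ ⟨∅, rfl⟩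
    obtain ⟨I, hI⟩ := X.closed
    let ε : Fin m ⊕ Fin 0 → Fin m := Sum.elim id Fin.elim0
    refine ⟨I ∪ (MvPolynomial.rename ε '' J), ?_⟩
    ext y
    have e1 : ∀ a : Fin 0 → k, y ∘ ε = Sum.elim y a := by
      intro a
      ext (i | i)
      · rfl
      · exact i.elim0
    have h1 : y ∈ orbitSet X x ↔ (y, (Fin.elim0 : Fin 0 → k)) ∈
        {y : (Fin m → k) × (Fin 0 → k) |
              y.1 ∈ X.carrier ∧ Sum.elim y.1 y.2 ∈ zeroLocus J} := by
      rw [← hJ]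
      constructor
      · rintro ⟨g, hg, rfl⟩
        refine ⟨(pi.toFun g, Fin.elim0), ⟨pi.mem g hg, by simp [zeroLocus]⟩, ?_⟩
        rw [hF g hg]
      · rintro ⟨⟨p, a⟩, ⟨hp, -⟩, he⟩
        obtain ⟨g, hg, rfl⟩ := hsurj p hp
        refine ⟨g, hg, ?_⟩
        rw [← hF g hg]
        exact congrArg Prod.fst he
    rw [h1, Set.mem_ofPred_eq]
    dsimp only
    rw [hI]
    constructor
    · rintro ⟨h2, h3⟩ f (hf | ⟨f, hf, rfl⟩)
      · exact h2 f hf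
      · rw [MvPolynomial.eval_rename, e1 Fin.elim0]
        exact h3 f hf
    · intro h2
      refine ⟨fun f hf => h2 f (Or.inl hf), fun f hf => ?_⟩
      have := h2 _ (Or.inr ⟨f, hf, rfl⟩)
      rwa [MvPolynomial.eval_rename, e1 Fin.elim0] at this
  · rw [cosets_finite_iff X pi x hker]
    have hcoord : ∀ ij : Fin Ghat.n × Fin Ghat.n, ∃ T : Set k, T.Finite ∧
        ∀ s ∈ pi.toFun '' stabSet X x, mat2pt (s : Matrix (Fin Ghat.n) (Fin Ghat.n) k) ij ∈ T := by
      intro ij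
      obtain ⟨J, hJ⟩ := H 1 _ ⟨{MvPolynomial.X (Sum.inl ij) * MvPolynomial.X (Sum.inr 0) - 1}, rfl⟩
      have hnot : ¬ ((x, fun _ => 0) : (Fin m → k) × (Fin 1 → k)) ∈
          {y : (Fin m → k) × (Fin 1 → k) |
              y.1 ∈ X.carrier ∧ Sum.elim y.1 y.2 ∈ zeroLocus J} := by
        rw [← hJ]
        rintro ⟨⟨p, a⟩, ⟨hp, hz⟩, he⟩
        have ha : a = fun _ => 0 := (congrArg Prod.snd he).symm
        have := hz _ rfl
        simp [ha] at this
      have hex : ∃ f ∈ J, MvPolynomial.eval (Sum.elim x (fun _ => 0)) f ≠ 0 := by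
        by_contra! hcon
        exact hnot ⟨hx, hcon⟩
      obtain ⟨f, hf, hf0⟩ := hex
      let u : Polynomial k := MvPolynomial.aeval
        (Sum.elim (fun i => Polynomial.C (x i)) (fun _ => Polynomial.X)) f
      have hu : ∀ t, u.eval t = MvPolynomial.eval (Sum.elim x (fun _ => t)) f := by
        intro t
        simp only [u]
        clear_value u
        clear hf hf0
        induction f using MvPolynomial.induction_on with
        | C a => simp
        | add p q hp hq => simp only [map_add, Polynomial.eval_add, hp, hq]
        | mul_X p i hp =>
          simp only [map_mul, Polynomial.eval_mul, hp]
          rcases i with i | i <;> simp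
      have hu0 : u ≠ 0 := by
        intro h
        apply hf0
        rw [← hu, h, Polynomial.eval_zero]
      refine ⟨{0} ∪ (fun t => t⁻¹) '' {t | u.IsRoot t},
        (Set.finite_singleton _).union ((Polynomial.finite_setOfPred_isRoot hu0).image _), ?_⟩
      rintro _ ⟨g, hg, rfl⟩
      set c := mat2pt (pi.toFun g : Matrix (Fin Ghat.n) (Fin Ghat.n) k) ij with hc
      by_cases hc0 : c = 0
      · exact Or.inl hc0
      · refine Or.inr ⟨c⁻¹, ?_, inv_inv c⟩
        have hmem : ((x, fun _ => c⁻¹) : (Fin m → k) × (Fin 1 → k)) ∈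
            {y : (Fin m → k) × (Fin 1 → k) |
              y.1 ∈ X.carrier ∧ Sum.elim y.1 y.2 ∈ zeroLocus J} := by
          rw [← hJ]
          refine ⟨(pi.toFun g, fun _ => c⁻¹), ⟨pi.mem g hg.1, ?_⟩, ?_⟩
          · rintro _ rfl
            simp [← hc, hc0]
          · rw [hF g hg.1, hg.2]
        change u.eval _ = 0
        rw [hu]
        exact hmem.2 f hf
    choose T hT hT' using hcoord
    have hfin := Set.Finite.pi hT
    refine Set.Finite.of_finite_image (f := fun s : GL (Fin Ghat.n) k =>
      mat2pt (s : Matrix (Fin Ghat.n) (Fin Ghat.n) k)) (hfin.subset ?_) ?_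
    · rintro _ ⟨s, hs, rfl⟩ ij -
      exact hT' ij s hs
    · intro s _ s' _ h
      exact mat2pt_inj h

theorem stable_imp_proper
    {k : Type} [Field k] [IsAlgClosed k]
    (G Ghat : AlgGroup k)
    {m : ℕ} (X : GVariety G m)
    (pi : AlgGroupHom G Ghat) (hsurj : pi.Surj)
    (hker : ∀ g ∈ G.toSubgroup, (pi.toFun g = 1 ↔ g ∈ actionCenter X))
    (x : Fin m → k) (hx : x ∈ X.carrier)
    (F : GL (Fin Ghat.n) k → (Fin m → k))
    (hF : ∀ g ∈ G.toSubgroup, F (pi.toFun g) = X.act g x)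
    (hst : Stable X x)
    (q : ℕ) (C : Set (GL (Fin Ghat.n) k × (Fin q → k)))
    (hC : ∃ I : Set (MvPolynomial ((Fin Ghat.n × Fin Ghat.n) ⊕ Fin q) k),
          C = {p | p.1 ∈ Ghat.toSubgroup ∧
                Sum.elim (mat2pt (p.1 : Matrix (Fin Ghat.n) (Fin Ghat.n) k)) p.2 ∈
                  zeroLocus I}) :
        ∃ J : Set (MvPolynomial (Fin m ⊕ Fin q) k),
          {y : (Fin m → k) × (Fin q → k) | ∃ p ∈ C, y = (F p.1, p.2)} =
            {y : (Fin m → k) × (Fin q → k) |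
              y.1 ∈ X.carrier ∧ Sum.elim y.1 y.2 ∈ zeroLocus J} := by
  classical
  obtain ⟨⟨Iorb, hIorb⟩, hfin⟩ := hst
  rw [cosets_finite_iff X pi x hker] at hfin
  obtain ⟨I, hI⟩ := hC
  obtain ⟨P, hP⟩ := X.regular
  obtain ⟨pp, hpp⟩ := pi.regular
  let S := pi.toFun '' stabSet X x
  let Γ : Set ((Fin G.n × Fin G.n) ⊕ Unit → k) := emb '' (G.toSubgroup : Set (GL (Fin G.n) k))
  let θ : Fin m → MvPolynomial ((Fin G.n × Fin G.n) ⊕ Unit) k := fun i =>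
    MvPolynomial.aeval (Sum.elim (fun ij => MvPolynomial.X (Sum.inl ij))
      (Sum.elim (fun _ => MvPolynomial.X (Sum.inr ())) (fun l => MvPolynomial.C (x l)))) (P i)
  let Θ : ((Fin G.n × Fin G.n) ⊕ Unit → k) → (Fin m → k) := fun v i => MvPolynomial.eval v (θ i)
  have hΘ : ∀ g ∈ G.toSubgroup, Θ (emb g) = X.act g x := by
    intro g hg
    ext i
    rw [hP g hg x hx i]
    simp only [Θ, θ]
    rw [eval_aeval']
    congr 2
    ext (ij | ⟨⟨⟩⟩ | l) <;> simp [emb]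
  obtain ⟨e, ⟨_, ⟨g0, hg0, rfl⟩, he⟩, hsep⟩ := generic_sep Γ ⟨_, 1, one_mem _, rfl⟩
    (emb_sep G) θ Θ (fun _ _ => rfl)
  refine ⟨{w | ∀ p ∈ C, MvPolynomial.eval (Sum.elim (F p.1) p.2) w = 0}, ?_⟩
  ext ⟨y, a⟩
  constructor
  · rintro ⟨⟨p, b⟩, hp, hpe⟩
    obtain ⟨rfl, rfl⟩ := Prod.mk.inj hpe
    refine ⟨?_, fun w hw => hw _ hp⟩
    have hp1 : p ∈ Ghat.toSubgroup := by rw [hI] at hp; exact hp.1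
    obtain ⟨g, hg, rfl⟩ := hsurj p hp1
    dsimp only
    rw [hF g hg]
    exact X.act_mem g hg x hx
  · rintro ⟨hy, hJ⟩
    dsimp only at hy hJ
    have horb : y ∈ orbitSet X x := by
      rw [hIorb]
      intro f hf
      have := hJ (MvPolynomial.rename Sum.inl f) (by
        intro p hp
        rw [MvPolynomial.eval_rename, Sum.elim_comp_inl]
        have hp1 : p.1 ∈ Ghat.toSubgroup := by rw [hI] at hp; exact hp.1
        obtain ⟨g, hg, hgp⟩ := hsurj p.1 hp1
        have : F p.1 ∈ orbitSet X x := ⟨g, hg, by rw [← hgp, hF g hg]⟩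
        rw [hIorb] at this
        exact this f hf)
      rwa [MvPolynomial.eval_rename, Sum.elim_comp_inl] at this
    obtain ⟨g1, hg1, rfl⟩ := horb
    by_contra hZ
    let h : GL (Fin G.n) k := g1 * g0⁻¹
    have hh : h ∈ G.toSubgroup := mul_mem hg1 (inv_mem hg0)
    let Ch : Set (((Fin G.n × Fin G.n) ⊕ Unit → k) × (Fin q → k)) :=
      {z | ∃ g ∈ G.toSubgroup, z.1 = emb g ∧ ∃ s ∈ S, (pi.toFun (h * g) * s, z.2) ∈ C}
    refine Exists.elim (hsep (Fin q) Ch ?_ ?_ ?_ (emb g0) a ⟨g0, hg0, rfl⟩ he ?_) ?_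
    rotate_left 4
    · rintro w ⟨hw, hw0⟩
      let w' : MvPolynomial (Fin m ⊕ Fin q) k := MvPolynomial.aeval
        (Sum.elim (fun i => MvPolynomial.aeval (Sum.elim
          (fun ij => MvPolynomial.C
            (mat2pt ((h⁻¹ : GL (Fin G.n) k) : Matrix (Fin G.n) (Fin G.n) k) ij))
          (Sum.elim (fun _ => MvPolynomial.C
            (((h⁻¹)⁻¹ : GL (Fin G.n) k) : Matrix (Fin G.n) (Fin G.n) k).det)
            (fun l => MvPolynomial.X (Sum.inl l)))) (P i))
          (fun j => MvPolynomial.X (Sum.inr j))) w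
      have hw' : ∀ y ∈ X.carrier, ∀ b, MvPolynomial.eval (Sum.elim y b) w' =
          MvPolynomial.eval (Sum.elim (X.act h⁻¹ y) b) w := by
        intro y hy b
        simp only [w']
        rw [eval_aeval']
        congr 2
        ext (i | j)
        · simp only [Sum.elim_inl]
          rw [hP h⁻¹ (inv_mem hh) y hy i, eval_aeval']
          congr 2
          ext (ij | ⟨⟨⟩⟩ | l) <;> simp
        · simp
      have h1 := hJ w' (by
        rintro ⟨p, b⟩ hp
        have hp1 : p ∈ Ghat.toSubgroup := by rw [hI] at hp; exact hp.1
        obtain ⟨g, hg, rfl⟩ := hsurj p hp1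
        dsimp only
        rw [hF g hg, hw' _ (X.act_mem g hg x hx), ← X.act_mul _ (inv_mem hh) _ hg x hx,
          ← hΘ _ (mul_mem (inv_mem hh) hg)]
        refine hw _ _ ⟨h⁻¹ * g, mul_mem (inv_mem hh) hg, rfl, 1,
          ⟨1, ⟨one_mem _, X.act_one x hx⟩, pi.map_one⟩, ?_⟩
        rw [mul_one, mul_inv_cancel_left]
        exact hp)
      rw [hw' _ (X.act_mem g1 hg1 x hx), ← X.act_mul _ (inv_mem hh) _ hg1 x hx] at h1
      have h2 : h⁻¹ * g1 = g0 := by simp [h]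
      rw [h2, ← hΘ g0 hg0] at h1
      exact hw0 h1
    ·
      intro v b hvb
      by_cases hv : v ∈ Γ
      · obtain ⟨g, hg, rfl⟩ := hv
        have hex : ∀ s : GL (Fin Ghat.n) k, ∃ f : MvPolynomial ((Fin G.n × Fin G.n ⊕ Unit) ⊕ Fin q) k,
            s ∈ S → (∀ g' ∈ G.toSubgroup, ∀ b', (pi.toFun (h * g') * s, b') ∈ C →
              MvPolynomial.eval (Sum.elim (emb g') b') f = 0) ∧
              MvPolynomial.eval (Sum.elim (emb g) b) f ≠ 0 := by
          intro s
          by_cases hs : s ∈ S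
          swap
          · exact ⟨0, fun h => absurd h hs⟩
          have hsG : s ∈ Ghat.toSubgroup := by
            obtain ⟨t, ht, rfl⟩ := hs
            exact pi.mem t ht.1
          have hnot : (pi.toFun (h * g) * s, b) ∉ C := fun hc => hvb ⟨g, hg, rfl, s, hs, hc⟩
          have hex : ∃ f ∈ I, MvPolynomial.eval (Sum.elim (mat2pt
              ((pi.toFun (h * g) * s : GL (Fin Ghat.n) k) :
                Matrix (Fin Ghat.n) (Fin Ghat.n) k)) b) f ≠ 0 := by
            by_contra! hcon
            apply hnot
            rw [hI]
            exact ⟨mul_mem (pi.mem _ (mul_mem hh hg)) hsG, hcon⟩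
          obtain ⟨f, hf, hf0⟩ := hex
          let f' : MvPolynomial ((Fin G.n × Fin G.n ⊕ Unit) ⊕ Fin q) k := MvPolynomial.aeval
            (Sum.elim (fun ij => MvPolynomial.rename Sum.inl
              (∑ c, ((∑ d, MvPolynomial.C ((pi.toFun h : Matrix (Fin Ghat.n) (Fin Ghat.n) k) ij.1 d)
                * pp (d, c)) * MvPolynomial.C ((s : Matrix (Fin Ghat.n) (Fin Ghat.n) k) c ij.2))))
              (fun j => MvPolynomial.X (Sum.inr j))) f
          have hf' : ∀ g' ∈ G.toSubgroup, ∀ b', MvPolynomial.eval (Sum.elim (emb g') b') f' =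
              MvPolynomial.eval (Sum.elim (mat2pt
              ((pi.toFun (h * g') * s : GL (Fin Ghat.n) k) :
                Matrix (Fin Ghat.n) (Fin Ghat.n) k)) b') f := by
            intro g' hg' b'
            simp only [f']
            rw [eval_aeval']
            congr 2
            ext (⟨i, j⟩ | j)
            · simp only [Sum.elim_inl]
              rw [MvPolynomial.eval_rename, Sum.elim_comp_inl, pi.map_mul h hh g' hg']
              simp only [mat2pt, Units.val_mul, Matrix.mul_apply, map_sum, map_mul,
                MvPolynomial.eval_C]
              refine Finset.sum_congr rfl fun c _ => ?_
              congr 1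
              refine Finset.sum_congr rfl fun d _ => ?_
              rw [hpp g' hg' (d, c)]
              rfl
            · simp
          refine ⟨f', fun _ => ⟨?_, by rwa [hf' g hg]⟩⟩
          intro g' hg' b' hb'
          rw [hf' g' hg']
          rw [hI] at hb'
          exact hb'.2 f hf
        choose f hf using hex
        refine ⟨∏ s ∈ hfin.toFinset, f s, ?_, ?_⟩
        · rintro _ b' ⟨g', hg', h1, s, hs, hsC⟩
          dsimp only at h1
          subst h1
          rw [map_prod]
          exact Finset.prod_eq_zero (hfin.mem_toFinset.2 hs) ((hf s hs).1 g' hg' b' hsC)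
        · rw [map_prod]
          exact Finset.prod_ne_zero_iff.2 fun s hs => (hf s (hfin.mem_toFinset.1 hs)).2
      · obtain ⟨f, hf, hf0⟩ := emb_sep G v hv
        refine ⟨MvPolynomial.rename Sum.inl f, ?_, ?_⟩
        · rintro _ b' ⟨g', hg', h1, -⟩
          dsimp only at h1
          subst h1
          rw [MvPolynomial.eval_rename, Sum.elim_comp_inl]
          exact hf _ ⟨g', hg', rfl⟩
        · rwa [MvPolynomial.eval_rename, Sum.elim_comp_inl]
    ·
      rintro _ b _ ⟨g, hg, h1, s, ⟨t, ht, rfl⟩, hsC⟩ ⟨g', hg', rfl⟩ hΘΘ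
      dsimp only at h1 hsC
      subst h1
      rw [hΘ g hg, hΘ g' hg'] at hΘΘ
      have hgg : g'⁻¹ * g ∈ G.toSubgroup := mul_mem (inv_mem hg') hg
      have hst : X.act (g'⁻¹ * g) x = x := by
        rw [X.act_mul _ (inv_mem hg') _ hg x hx, hΘΘ, ← X.act_mul _ (inv_mem hg') _ hg' x hx,
          inv_mul_cancel, X.act_one x hx]
      refine ⟨g', hg', rfl, pi.toFun (g'⁻¹ * g * t), ⟨_, ⟨mul_mem hgg ht.1, ?_⟩, rfl⟩, ?_⟩
      · rw [X.act_mul _ hgg _ ht.1 x hx, ht.2, hst]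
      · dsimp only
        rw [← pi.map_mul _ (mul_mem hh hg') _ (mul_mem hgg ht.1)]
        rw [← pi.map_mul _ (mul_mem hh hg) _ ht.1] at hsC
        have : h * g' * (g'⁻¹ * g * t) = h * g * t := by group
        rw [this]
        exact hsC
    · rintro _ b ⟨g, hg, h1, -⟩
      dsimp only at h1
      subst h1
      exact ⟨g, hg, rfl⟩
    · rintro ⟨g, hg, h1, s, ⟨t, ht, rfl⟩, hsC⟩
      dsimp only at h1 hsC
      have := emb_inj h1
      subst this
      apply hZ
      refine ⟨_, hsC, ?_⟩
      have h2 : h * g0 = g1 := by simp [h]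
      dsimp only
      rw [h2, ← pi.map_mul _ hg1 _ ht.1, hF _ (mul_mem hg1 ht.1), X.act_mul _ hg1 _ ht.1 x hx, ht.2]

/-- Proposition 3.7 of the paper. A point `x` of an affine
`G`-variety `X` is stable if and only if the reduced orbit morphism
`ψ̂_x : G/G_X → X`, `gG_X ↦ g·x`, is a proper morphism. Here the quotient
`G/G_X` is modelled by an affine algebraic group `Ĝ` together with a
surjective morphism `π : G → Ĝ` with kernel `G_X`; the reduced orbit morphism
is the map `F` with `F(π(g)) = g·x`; and properness of a morphism of affine
varieties means universal closedness: for every `q`, the induced map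
`Ĝ × 𝔸^q → X × 𝔸^q` takes closed subsets to closed subsets. -/
theorem stable_iff_reduced_orbit_map_proper
    {k : Type} [Field k] [IsAlgClosed k] [CharZero k]
    (G Ghat : AlgGroup k) (hG : IsReductive G)
    {m : ℕ} (X : GVariety G m)
    (pi : AlgGroupHom G Ghat) (hsurj : pi.Surj)
    (hker : ∀ g ∈ G.toSubgroup, (pi.toFun g = 1 ↔ g ∈ actionCenter X))
    (x : Fin m → k) (hx : x ∈ X.carrier)
    (F : GL (Fin Ghat.n) k → (Fin m → k))
    (hF : ∀ g ∈ G.toSubgroup, F (pi.toFun g) = X.act g x) :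
    Stable X x ↔
      ∀ (q : ℕ) (C : Set (GL (Fin Ghat.n) k × (Fin q → k))),
        (∃ I : Set (MvPolynomial ((Fin Ghat.n × Fin Ghat.n) ⊕ Fin q) k),
          C = {p | p.1 ∈ Ghat.toSubgroup ∧
                Sum.elim (mat2pt (p.1 : Matrix (Fin Ghat.n) (Fin Ghat.n) k)) p.2 ∈
                  zeroLocus I}) →
        ∃ J : Set (MvPolynomial (Fin m ⊕ Fin q) k),
          {y : (Fin m → k) × (Fin q → k) | ∃ p ∈ C, y = (F p.1, p.2)} =
            {y : (Fin m → k) × (Fin q → k) |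
              y.1 ∈ X.carrier ∧ Sum.elim y.1 y.2 ∈ zeroLocus J} := by
  constructor
  · intro hst q C hC
    exact stable_imp_proper G Ghat X pi hsurj hker x hx F hF hst q C hC
  · intro H
    exact proper_imp_stable G Ghat X pi hsurj hker x hx F hF H

end PaperGIT
end

section
/- Let f: G → G' be a surjective morphism of affine algebraic groups over an algebraically closed field k of characteristic zero, and let f_*: Y(G) → Y(G') be the induced map on one-parameter subgroups given by composition with f. Then for every one-parameter subgroup μ ∈ Y(G') there exist λ ∈ Y(G) and a positive integer p such that f_*(λ) = μ^p. -/
open scoped MatrixGroups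

namespace PaperGIT

variable {k : Type} [Field k]

section LiftHelpers
open Matrix

lemma aux_char {k : Type} [Field k] [CharZero k] (s : Finset kˣ) (two : kˣ) (h2 : (two : k) = 2) :
    ∃ (A : Subgroup kˣ) (φ : A →* Multiplicative ℤ) (N : ℕ) (h : two ∈ A), 0 < N ∧
      (∀ x ∈ s, x ∈ A) ∧ φ ⟨two, h⟩ = Multiplicative.ofAdd (N : ℤ) := by
  have hinj : Function.Injective (zmultiplesHom (Additive kˣ) (Additive.ofMul two)) := by
    rw [injective_iff_map_eq_zero]
    intro z hz
    have h1 : two ^ z = 1 := by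
      have := congrArg Additive.toMul hz
      simpa using this
    have h3 : ((2 : ℚ) ^ z) = 1 := by
      have := congrArg (Units.val) h1
      rw [Units.val_zpow_eq_zpow_val, h2, Units.val_one] at this
      have h4 : (((2 : ℚ) ^ z : ℚ) : k) = ((1 : ℚ) : k) := by
        push_cast; exact this
      exact_mod_cast h4
    by_contra hne
    rw [zpow_eq_one_iff_of_ne_zero₀ hne] at h3
    norm_num at h3
  obtain ⟨ψ, hψ⟩ := (Module.Baer.of_divisible ℚ).extension_property_addMonoidHom _ hinj
    (Int.castAddHom ℚ)
  have hψ2 : ψ (Additive.ofMul two) = 1 := by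
    have := DFunLike.congr_fun hψ 1
    simpa using this
  set N : ℕ := ∏ x ∈ s, (ψ (Additive.ofMul x)).den with hN
  have hNpos : 0 < N := Finset.prod_pos fun x _ => (ψ (Additive.ofMul x)).den_pos
  let A : Subgroup kˣ :=
    { carrier := {x | ∃ z : ℤ, (N : ℚ) * ψ (Additive.ofMul x) = z}
      one_mem' := ⟨0, by simp⟩
      mul_mem' := by
        rintro x y ⟨z, hz⟩ ⟨w, hw⟩
        exact ⟨z + w, by rw [ofMul_mul, map_add, mul_add, hz, hw]; push_cast; rfl⟩
      inv_mem' := by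
        rintro x ⟨z, hz⟩
        exact ⟨-z, by rw [ofMul_inv, map_neg, mul_neg, hz]; push_cast; rfl⟩ }
  have hA : ∀ x : A, ∃ z : ℤ, (N : ℚ) * ψ (Additive.ofMul (x : kˣ)) = z := fun x => x.2
  choose F hF using hA
  refine ⟨A, MonoidHom.mk' (fun x => Multiplicative.ofAdd (F x)) ?_, N,
    ⟨N, by rw [hψ2]; simp⟩, hNpos, ?_, ?_⟩
  · intro x y
    rw [← ofAdd_add]
    congr 1
    have : ((F (x * y) : ℤ) : ℚ) = ((F x + F y : ℤ) : ℚ) := by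
      rw [← hF]; push_cast; rw [← hF, ← hF, ← mul_add, ← map_add]; rfl
    exact_mod_cast this
  · intro x hx
    obtain ⟨c, hc⟩ : (ψ (Additive.ofMul x)).den ∣ N := Finset.dvd_prod_of_mem _ hx
    refine ⟨c * (ψ (Additive.ofMul x)).num, ?_⟩
    rw [hc]
    push_cast
    have := Rat.mul_den_eq_num (ψ (Additive.ofMul x))
    linear_combination (c : ℚ) * this
  · simp only [MonoidHom.mk'_apply]
    congr 1
    have := hF ⟨two, ⟨N, by rw [hψ2]; simp⟩⟩
    have h5 : (N : ℚ) * ψ (Additive.ofMul two) = _ := this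
    simp only [hψ2, mul_one] at h5
    replace this := h5
    exact_mod_cast this.symm

/-- The shift operator on sequences. -/
noncomputable def shiftOp (k : Type) [Field k] : Module.End k (ℕ → k) where
  toFun u := fun m => u (m + 1)
  map_add' _ _ := rfl
  map_smul' _ _ := rfl

lemma aux_gen {k : Type} [Field k] (b : k) (n : ℕ) : ∀ q : Polynomial k, q.degree < n →
    ((shiftOp k - algebraMap k _ b) ^ n) (fun m : ℕ => q.eval (m : k) * b ^ m) = 0 := by
  induction n with
  | zero =>
    intro q hq
    have : q = 0 := by
      rw [← Polynomial.degree_eq_bot]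
      simpa using hq
    subst this
    ext; simp
  | succ n ih =>
    intro q hq
    rw [pow_succ, Module.End.mul_apply]
    have key : (shiftOp k - algebraMap k _ b) (fun m : ℕ => q.eval (m : k) * b ^ m) =
        fun m : ℕ => ((Polynomial.C b) * (Polynomial.taylor 1 q - q)).eval (m : k) * b ^ m := by
      ext m
      simp [shiftOp, Module.algebraMap_end_apply, Polynomial.taylor_eval]
      ring
    rw [key]
    apply ih
    refine lt_of_le_of_lt ((Polynomial.degree_mul_le _ _).trans (add_le_of_nonpos_left Polynomial.degree_C_le)) ?_
    by_cases h0 : q = 0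
    · subst h0; simp [Ne.bot_lt]
    have h1 : (Polynomial.taylor 1 q - q).degree < q.degree := by
      have := Polynomial.degree_sub_lt_left (p := Polynomial.taylor 1 q) (q := q)
        (by simp) (by simpa using h0)
        (by simp)
      simpa using this
    refine lt_of_lt_of_le h1 ?_
    rw [Polynomial.degree_eq_natDegree h0] at hq ⊢
    have h6 : q.natDegree < n + 1 := by exact_mod_cast hq
    exact_mod_cast Nat.lt_succ_iff.1 h6

lemma aux_indep {k : Type} [Field k] [CharZero k] (s : Finset kˣ) (q : kˣ → Polynomial k)
    (h : ∀ m : ℕ, ∑ b ∈ s, (q b).eval (m : k) * (b : k) ^ m = 0) : ∀ b ∈ s, q b = 0 := by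
  have hind := (shiftOp k).independent_maxGenEigenspace.comp (f := fun b : kˣ => (b : k))
    Units.val_injective
  classical
  have h2 := (iSupIndep_iff_finsetSum_eq_zero_imp_eq_zero _).1 hind s
    (fun b m => (q b).eval (m : k) * (b : k) ^ m) ?_ ?_
  · intro b hb
    have h3 := h2 b hb
    refine Polynomial.eq_zero_of_infinite_isRoot _ (Set.Infinite.mono ?_
      (Set.infinite_range_of_injective (Nat.cast_injective (R := k))))
    rintro _ ⟨m, rfl⟩
    have := congrFun h3 m
    simpa using this
  · intro b hb
    rw [Function.comp_apply, Module.End.mem_maxGenEigenspace]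
    exact ⟨(q b).natDegree + 1, aux_gen _ _ _ (by
      refine lt_of_le_of_lt Polynomial.degree_le_natDegree ?_
      exact_mod_cast Nat.lt_succ_self _)⟩
  · ext m
    simpa using h m

lemma aux_diag {k : Type} [Field k] [IsAlgClosed k] {n : ℕ} (s : Module.End k (Fin n → k))
    (hs : s.IsSemisimple) : ∃ (P : GL (Fin n) k) (a : Fin n → k),
    LinearMap.toMatrix' s = (P : Matrix (Fin n) (Fin n) k) * diagonal a * (P⁻¹ : GL (Fin n) k) := by
  classical
  have htop := hs.iSup_eigenspace_eq_top
  have hInternal := DirectSum.isInternal_submodule_of_iSupIndep_of_iSup_eq_top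
    s.eigenspaces_iSupIndep htop
  let B := hInternal.collectedBasis fun μ => Module.finBasis k (s.eigenspace μ)
  have : Fintype (Σ μ : k, Fin (Module.finrank k (s.eigenspace μ))) :=
    FiniteDimensional.fintypeBasisIndex B
  have hcard : Fintype.card (Σ μ : k, Fin (Module.finrank k (s.eigenspace μ))) = n := by
    rw [← Module.finrank_eq_card_basis B]; simp
  let e := Fintype.equivFinOfCardEq hcard
  let B' := B.reindex e
  have hB' : ∀ i, s (B' i) = (e.symm i).1 • B' i := by
    intro i
    have : B' i ∈ s.eigenspace (e.symm i).1 := by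
      simp only [B', Module.Basis.reindex_apply]
      exact hInternal.collectedBasis_mem _ _
    exact Module.End.mem_eigenspace_iff.1 this
  let P : Matrix (Fin n) (Fin n) k := (Pi.basisFun k (Fin n)).toMatrix B'
  let Q : Matrix (Fin n) (Fin n) k := B'.toMatrix (Pi.basisFun k (Fin n))
  have hPQ : P * Q = 1 := Module.Basis.toMatrix_mul_toMatrix_flip _ _
  have hQP : Q * P = 1 := Module.Basis.toMatrix_mul_toMatrix_flip _ _
  refine ⟨⟨P, Q, hPQ, hQP⟩, fun i => (e.symm i).1, ?_⟩
  change _ = P * _ * Q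
  have h1 : LinearMap.toMatrix' s * P = P * diagonal fun i => (e.symm i).1 := by
    ext i j
    rw [Matrix.mul_diagonal]
    have := congrFun (hB' j) i
    have h2 : (LinearMap.toMatrix' s *ᵥ (B' j)) i = (s (B' j)) i := by
      rw [LinearMap.toMatrix'_mulVec]
    rw [this] at h2
    simp only [Pi.smul_apply, smul_eq_mul] at h2
    rw [mul_comm]
    exact h2
  rw [← h1, mul_assoc, hPQ, mul_one]

lemma aux_jordan {k : Type} [Field k] [IsAlgClosed k] [CharZero k] {n : ℕ} (g : GL (Fin n) k) :
    ∃ (P : GL (Fin n) k) (a : Fin n → kˣ) (W : Matrix (Fin n) (Fin n) k) (r : ℕ),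
      W ^ r = 0 ∧
      Commute ((P : Matrix (Fin n) (Fin n) k) * diagonal (fun i => (a i : k)) *
        (P⁻¹ : GL (Fin n) k)) W ∧
      (g : Matrix (Fin n) (Fin n) k) = ((P : Matrix (Fin n) (Fin n) k) *
        diagonal (fun i => (a i : k)) * (P⁻¹ : GL (Fin n) k)) * (1 + W) := by
  classical
  obtain ⟨ν, hν, s, hs, hnil, hss, hsum⟩ :=
    Module.End.exists_isNilpotent_isSemisimple
      (f := Matrix.toLin' (g : Matrix (Fin n) (Fin n) k))
  have hcomm : Commute ν s := Algebra.commute_of_mem_adjoin_singleton_of_commute hs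
    (Algebra.commute_of_mem_adjoin_self hν).symm
  obtain ⟨P, a, hP⟩ := aux_diag s hss
  let S := LinearMap.toMatrix' s
  let V := LinearMap.toMatrix' ν
  have hg : (g : Matrix (Fin n) (Fin n) k) = V + S := by
    have := congrArg LinearMap.toMatrix' hsum
    simpa [S, V] using this
  have hVS : Commute V S := by
    have := congrArg LinearMap.toMatrix' hcomm.eq
    rw [LinearMap.toMatrix'_mul, LinearMap.toMatrix'_mul] at this
    exact this
  have hV : IsNilpotent V := by
    obtain ⟨r, hr⟩ := hnil
    refine ⟨r, ?_⟩
    have : V ^ r = LinearMap.toMatrixAlgEquiv' (ν ^ r) := by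
      rw [map_pow]; rfl
    rw [this, hr, map_zero]
  have hSu : IsUnit S := by
    have h1 : S = (g : Matrix (Fin n) (Fin n) k) - V := by rw [hg]; simp
    have hgV : Commute (g : Matrix (Fin n) (Fin n) k) V := by
      rw [hg]; exact (Commute.refl V).add_left hVS.symm
    rw [h1, sub_eq_add_neg, add_comm]
    exact hV.neg.isUnit_add_right_of_commute g.isUnit (hgV.symm.neg_left)
  have hS : S = (P : Matrix (Fin n) (Fin n) k) * diagonal a * (P⁻¹ : GL (Fin n) k) := hP
  have ha : ∀ i, a i ≠ 0 := by
    have : IsUnit (diagonal a) := by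
      have h2 : diagonal a = ((P⁻¹ : GL (Fin n) k) : Matrix (Fin n) (Fin n) k) * S * P := by
        rw [hS]; simp [mul_assoc]
      rw [h2]
      exact ((P⁻¹ : GL (Fin n) k).isUnit.mul hSu).mul P.isUnit
    rw [Matrix.isUnit_iff_isUnit_det, det_diagonal, isUnit_iff_ne_zero, Finset.prod_ne_zero_iff]
      at this
    exact fun i => this i (Finset.mem_univ i)
  obtain ⟨u, hu⟩ := hSu
  have huV : Commute ((u⁻¹ : (Matrix (Fin n) (Fin n) k)ˣ) : Matrix (Fin n) (Fin n) k) V := by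
    apply Commute.units_inv_left
    rw [hu]; exact hVS.symm
  obtain ⟨r, hr⟩ := hV
  have hSa : (P : Matrix (Fin n) (Fin n) k) * diagonal (fun i => ((Units.mk0 (a i) (ha i) : kˣ) : k)) *
        (P⁻¹ : GL (Fin n) k) = u := by
    rw [hu]; exact hS.symm
  refine ⟨P, fun i => Units.mk0 (a i) (ha i),
    ((u⁻¹ : (Matrix (Fin n) (Fin n) k)ˣ) : Matrix (Fin n) (Fin n) k) * V, r, ?_, ?_, ?_⟩
  · rw [huV.mul_pow, hr, mul_zero]
  · rw [hSa]
    refine Commute.mul_right ?_ ?_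
    · exact (Commute.refl _).units_inv_right
    · rw [hu]; exact hVS.symm
  · rw [hSa, mul_add, mul_one, ← mul_assoc, Units.mul_inv, one_mul, hg, hu, add_comm]

/-- Evaluation of an element of `k[X][A]`. -/
noncomputable def evR {k : Type} [Field k] {A : Subgroup kˣ} (x : k) (χ : A →* k) :
    MonoidAlgebra (Polynomial k) A →+* k :=
  MonoidAlgebra.liftNCRingHom (Polynomial.evalRingHom x) χ (fun _ _ => Commute.all _ _)

lemma evR_single {k : Type} [Field k] {A : Subgroup kˣ} (x : k) (χ : A →* k) (b : A)
    (q : Polynomial k) : evR x χ (MonoidAlgebra.single b q) = q.eval x * χ b := by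
  simp [evR]

/-- Constants. -/
noncomputable def cR {k : Type} [Field k] (A : Subgroup kˣ) :
    k →+* MonoidAlgebra (Polynomial k) A :=
  (MonoidAlgebra.singleOneRingHom).comp Polynomial.C

lemma evR_cR {k : Type} [Field k] {A : Subgroup kˣ} (x : k) (χ : A →* k) :
    (evR x χ).comp (cR A) = RingHom.id k := by
  ext a
  have : cR A a = MonoidAlgebra.single 1 (Polynomial.C a) := rfl
  simp [this, evR_single]

/-- The character `b ↦ b ^ m`. -/
noncomputable def chiN {k : Type} [Field k] (A : Subgroup kˣ) (m : ℕ) : A →* k :=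
  ((powMonoidHom m).comp (Units.coeHom k)).comp A.subtype

lemma evR_inj {k : Type} [Field k] [CharZero k] {A : Subgroup kˣ}
    (x y : MonoidAlgebra (Polynomial k) A)
    (h : ∀ m : ℕ, evR (m : k) (chiN A m) x = evR (m : k) (chiN A m) y) : x = y := by
  classical
  rw [← sub_eq_zero]
  have h' : ∀ m : ℕ, evR (m : k) (chiN A m) (x - y) = 0 := by
    intro m; rw [map_sub, h m, sub_self]
  generalize x - y = z at h'
  have hz : ∀ m : ℕ, evR (m : k) (chiN A m) z =
      ∑ b ∈ z.coeff.support, (z.coeff b).eval (m : k) * ((b : kˣ) : k) ^ m := by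
    intro m
    simp [evR, MonoidAlgebra.liftNCRingHom, MonoidAlgebra.liftNC, chiN, Finsupp.sum]
  have := aux_indep (z.coeff.support.map (Function.Embedding.subtype _))
    (fun b => if hb : b ∈ A then z.coeff ⟨b, hb⟩ else 0) ?_
  · ext1
    ext1 b
    by_contra hb
    have h1 := this b (by simpa using hb)
    simp at h1
    exact hb h1
  · intro m
    rw [← h' m, hz m, Finset.sum_map]
    apply Finset.sum_congr rfl
    intro b hb
    simp

/-- Binomial polynomial. -/
noncomputable def binomP (k : Type) [Field k] (j : ℕ) : Polynomial k :=
  Polynomial.C ((j.factorial : k)⁻¹) * descPochhammer k j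

lemma binomP_eval {k : Type} [Field k] [CharZero k] (j m : ℕ) :
    (binomP k j).eval (m : k) = (m.choose j : k) := by
  rw [binomP, Polynomial.eval_mul, Polynomial.eval_C, descPochhammer_eval_eq_descFactorial,
    Nat.descFactorial_eq_factorial_mul_choose]
  have : (j.factorial : k) ≠ 0 := by exact_mod_cast j.factorial_ne_zero
  push_cast
  field_simp

lemma aux_pow {k : Type} [Field k] {n : ℕ} (W : Matrix (Fin n) (Fin n) k) (r : ℕ)
    (hW : W ^ r = 0) (m : ℕ) :
    (1 + W) ^ m = ∑ j ∈ Finset.range (r + 1), (m.choose j : k) • W ^ j := by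
  rw [add_comm, (Commute.one_right W).add_pow]
  have h1 : ∀ j, W ^ j * 1 ^ (m - j) * (m.choose j : Matrix (Fin n) (Fin n) k) =
      (m.choose j : k) • W ^ j := by
    intro j
    rw [one_pow, mul_one, Nat.cast_smul_eq_nsmul, nsmul_eq_mul']
  simp_rw [h1]
  rw [Finset.sum_subset (Finset.range_mono (show m + 1 ≤ max m r + 1 by omega)),
    Finset.sum_subset (Finset.range_mono (show r + 1 ≤ max m r + 1 by omega))]
  · intro j _ hj
    have : r ≤ j := by simp at hj; omega
    rw [pow_eq_zero_of_le this hW, smul_zero]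
  · intro j _ hj
    have : m < j := by simp at hj; omega
    simp [Nat.choose_eq_zero_of_lt this]

/-- The universal interpolating matrix. -/
noncomputable def univM {k : Type} [Field k] {n : ℕ} (A : Subgroup kˣ) (P : GL (Fin n) k)
    (a : Fin n → A) (W : Matrix (Fin n) (Fin n) k) (r : ℕ) :
    Matrix (Fin n) (Fin n) (MonoidAlgebra (Polynomial k) A) :=
  ((cR A).mapMatrix (P : Matrix (Fin n) (Fin n) k) *
    diagonal (fun i => MonoidAlgebra.single (a i) 1) *
    (cR A).mapMatrix ((P⁻¹ : GL (Fin n) k) : Matrix (Fin n) (Fin n) k)) *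
  ∑ j ∈ Finset.range (r + 1),
    diagonal (fun _ => MonoidAlgebra.single 1 (binomP k j)) * (cR A).mapMatrix (W ^ j)

lemma ev_univM {k : Type} [Field k] {n : ℕ} (A : Subgroup kˣ) (P : GL (Fin n) k)
    (a : Fin n → A) (W : Matrix (Fin n) (Fin n) k) (r : ℕ) (x : k) (χ : A →* k) :
    (evR x χ).mapMatrix (univM A P a W r) =
      ((P : Matrix (Fin n) (Fin n) k) * diagonal (fun i => χ (a i)) * (P⁻¹ : GL (Fin n) k)) *
      ∑ j ∈ Finset.range (r + 1), (binomP k j).eval x • W ^ j := by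
  have hc : ∀ M : Matrix (Fin n) (Fin n) k, (evR x χ).mapMatrix ((cR A).mapMatrix M) = M := by
    intro M
    ext i j
    exact DFunLike.congr_fun (evR_cR x χ) (M i j)
  have hd : ∀ d : Fin n → MonoidAlgebra (Polynomial k) A,
      (evR x χ).mapMatrix (diagonal d) = diagonal fun i => evR x χ (d i) := by
    intro d
    simp [Matrix.diagonal_map]
  simp only [univM, map_mul, map_sum, hc, hd, evR_single, map_one, mul_one, Polynomial.eval_one,
    one_mul]
  congr 1
  apply Finset.sum_congr rfl
  intro j _
  ext i l
  simp [Matrix.diagonal_mul]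

lemma ev_univM_nat {k : Type} [Field k] [CharZero k] {n : ℕ} (A : Subgroup kˣ) (P : GL (Fin n) k)
    (a : Fin n → A) (W : Matrix (Fin n) (Fin n) k) (r : ℕ) (hW : W ^ r = 0)
    (hcomm : Commute ((P : Matrix (Fin n) (Fin n) k) *
      diagonal (fun i => (((a i : A) : kˣ) : k)) * (P⁻¹ : GL (Fin n) k)) W) (m : ℕ) :
    (evR (m : k) (chiN A m)).mapMatrix (univM A P a W r) =
      (((P : Matrix (Fin n) (Fin n) k) * diagonal (fun i => (((a i : A) : kˣ) : k)) *
        (P⁻¹ : GL (Fin n) k)) * (1 + W)) ^ m := by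
  rw [ev_univM, ((Commute.one_right _).add_right hcomm).mul_pow, aux_pow W r hW]
  congr 1
  · have := Units.conj_pow P (diagonal (fun i => (((a i : A) : kˣ) : k))) m
    rw [this, Matrix.diagonal_pow]
    rfl
  · simp_rw [binomP_eval]

lemma ev_univM_zero {k : Type} [Field k] [CharZero k] {n : ℕ} (A : Subgroup kˣ)
    (P : GL (Fin n) k)
    (a : Fin n → A) (W : Matrix (Fin n) (Fin n) k) (r : ℕ) (χ : A →* k) :
    (evR 0 χ).mapMatrix (univM A P a W r) =
      ((P : Matrix (Fin n) (Fin n) k) * diagonal (fun i => χ (a i)) * (P⁻¹ : GL (Fin n) k)) := by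
  rw [ev_univM, Finset.sum_eq_single 0]
  · have := binomP_eval (k := k) 0 0
    simp at this
    simp [this]
  · intro j _ hj
    have := binomP_eval (k := k) j 0
    rw [Nat.cast_zero] at this
    rw [this, Nat.choose_eq_zero_of_lt (Nat.pos_of_ne_zero hj)]
    simp
  · simp


/-- The diagonal one-parameter subgroup with weights `e`, conjugated by `P`. -/
noncomputable def diagHom {k : Type} [Field k] {n : ℕ} (P : GL (Fin n) k) (e : Fin n → ℤ) :
    kˣ →* GL (Fin n) k :=
  (MulAut.conj P).toMonoidHom.comp
    ((Units.map (Matrix.diagonalRingHom (Fin n) k).toMonoidHom).comp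
      ((MulEquiv.piUnits.symm.toMonoidHom).comp
        (MonoidHom.pi fun i => zpowGroupHom (e i))))

lemma diagHom_coe {k : Type} [Field k] {n : ℕ} (P : GL (Fin n) k) (e : Fin n → ℤ) (t : kˣ) :
    (diagHom P e t : Matrix (Fin n) (Fin n) k) =
      (P : Matrix (Fin n) (Fin n) k) * diagonal (fun i => ((t ^ e i : kˣ) : k)) *
        (P⁻¹ : GL (Fin n) k) := rfl

lemma diagHom_regular {k : Type} [Field k] {n : ℕ} (P : GL (Fin n) k) (e : Fin n → ℤ) :
    ∃ p : Fin n × Fin n → MvPolynomial Bool k,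
    ∀ (t : kˣ) (ij : Fin n × Fin n),
      (diagHom P e t : Matrix (Fin n) (Fin n) k) ij.1 ij.2 =
        MvPolynomial.eval (fun b => if b then (t : k) else ((t⁻¹ : kˣ) : k)) (p ij) := by
  refine ⟨fun ij => ∑ l, MvPolynomial.C ((P : Matrix (Fin n) (Fin n) k) ij.1 l) *
    (MvPolynomial.X true ^ (e l).toNat * MvPolynomial.X false ^ (-(e l)).toNat) *
    MvPolynomial.C (((P⁻¹ : GL (Fin n) k) : Matrix (Fin n) (Fin n) k) l ij.2), ?_⟩
  intro t ij
  rw [diagHom_coe, Matrix.mul_apply]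
  simp only [map_sum, map_mul, map_pow, MvPolynomial.eval_C, MvPolynomial.eval_X,
    Matrix.mul_diagonal]
  apply Finset.sum_congr rfl
  intro l _
  have : ((t ^ e l : kˣ) : k) = (t : k) ^ (e l).toNat * ((t⁻¹ : kˣ) : k) ^ (-(e l)).toNat := by
    rw [← Units.val_pow_eq_pow_val, ← Units.val_pow_eq_pow_val, ← Units.val_mul]
    congr 1
    rw [inv_pow, ← zpow_natCast, ← zpow_natCast, ← _root_.zpow_neg, ← _root_.zpow_add]
    congr 1
    omega
  rw [this]
  simp

lemma evR_eval₂ {k : Type} [Field k] {A : Subgroup kˣ} {σ : Type} (x : k) (χ : A →* k)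
    (v : σ → MonoidAlgebra (Polynomial k) A) (F : MvPolynomial σ k) :
    evR x χ (MvPolynomial.eval₂ (cR A) v F) = MvPolynomial.eval (fun i => evR x χ (v i)) F := by
  rw [MvPolynomial.hom_eval₂, evR_cR]
  rfl

end LiftHelpers

/-- Lemma 3.14 of the paper. Let `f : G → G'` be a
surjective morphism of affine algebraic groups. For every one-parameter
subgroup `μ` of `G'` there exist a one-parameter subgroup `λ` of `G` and a
positive integer `p` such that `f_*(λ) = μ^p`. -/
theorem onePS_lifts_up_to_power
    {k : Type} [Field k] [IsAlgClosed k] [CharZero k]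
    (G G' : AlgGroup k) (f : AlgGroupHom G G') (hsurj : f.Surj)
    (mu : OnePS G') :
    ∃ (lam : OnePS G) (p : ℕ), 0 < p ∧
      ∀ t : kˣ, f.toFun (lam.toFun t) = mu.toFun t ^ p := by
  classical
  let two : kˣ := Units.mk0 2 two_ne_zero
  have htwo : (two : k) = 2 := rfl
  obtain ⟨g, hgG, hfg⟩ := hsurj (mu.toFun two) (mu.mem two)
  obtain ⟨P, a, W, r, hW, hcomm, hg⟩ := aux_jordan g
  obtain ⟨A, φ, N, h2A, hN, hsA, hφ⟩ := aux_char
    (Finset.univ.image a ∪ {Matrix.GeneralLinearGroup.det g}) two htwo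
  have haA : ∀ i, a i ∈ A := fun i => hsA _ (by simp)
  have hdA : Matrix.GeneralLinearGroup.det g ∈ A := hsA _ (by simp)
  let a' : Fin G.n → A := fun i => ⟨a i, haA i⟩
  let δ : A := ⟨Matrix.GeneralLinearGroup.det g, hdA⟩
  let τ : A := ⟨two, h2A⟩
  let e : Fin G.n → ℤ := fun i => (φ (a' i)).toAdd
  let θ : kˣ → A →* k := fun t => (Units.coeHom k).comp ((zpowersHom kˣ t).comp φ)
  let M := univM A P a' W r
  have hMnat : ∀ m : ℕ, (evR (m : k) (chiN A m)).mapMatrix M =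
      ((g ^ m : GL (Fin G.n) k) : Matrix (Fin G.n) (Fin G.n) k) := by
    intro m
    rw [ev_univM_nat A P a' W r hW hcomm, Units.val_pow_eq_pow_val, hg]
  have hMzero : ∀ t : kˣ, (evR 0 (θ t)).mapMatrix M =
      (diagHom P e t : Matrix (Fin G.n) (Fin G.n) k) := by
    intro t
    rw [ev_univM_zero, diagHom_coe]
    rfl
  have hgm : ∀ m : ℕ, g ^ m ∈ G.toSubgroup := fun m => G.toSubgroup.pow_mem hgG m
  have hfgm : ∀ m : ℕ, f.toFun (g ^ m) = mu.toFun (two ^ m) := by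
    intro m
    induction m with
    | zero => simp [f.map_one]
    | succ m ih => rw [pow_succ, f.map_mul _ (hgm m) _ hgG, ih, hfg, pow_succ, map_mul]
  have hlamG : ∀ t : kˣ, diagHom P e t ∈ G.toSubgroup := by
    intro t
    obtain ⟨I, hI⟩ := G.closed
    rw [hI]
    intro F hF
    have h0 : MvPolynomial.eval₂ (cR A) (fun p : Fin G.n × Fin G.n => M p.1 p.2) F = 0 := by
      apply evR_inj
      intro m
      rw [evR_eval₂, map_zero]
      have := (hI (g ^ m)).1 (hgm m) F hF
      rw [← hMnat m] at this
      exact this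
    have h1 := congrArg (evR 0 (θ t)) h0
    rw [evR_eval₂, map_zero] at h1
    rw [← hMzero t]
    exact h1
  have hdet : M.det = MonoidAlgebra.single δ 1 := by
    apply evR_inj
    intro m
    rw [RingHom.map_det, hMnat, evR_single, Units.val_pow_eq_pow_val, Matrix.det_pow]
    simp [chiN, δ]
  refine ⟨⟨diagHom P e, hlamG, diagHom_regular P e⟩, N, hN, ?_⟩
  intro t
  obtain ⟨pf, hpf⟩ := f.regular
  obtain ⟨pm, hpm⟩ := mu.regular
  apply Units.ext
  ext i j
  let vM : (Fin G.n × Fin G.n) ⊕ Unit → MonoidAlgebra (Polynomial k) A :=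
    Sum.elim (fun p => M p.1 p.2) (fun _ => MonoidAlgebra.single δ⁻¹ 1)
  let vT : Bool → MonoidAlgebra (Polynomial k) A :=
    fun b => if b then MonoidAlgebra.single τ 1 else MonoidAlgebra.single τ⁻¹ 1
  have key : MvPolynomial.eval₂ (cR A) vM (pf (i, j)) =
      MvPolynomial.eval₂ (cR A) vT (pm (i, j)) := by
    apply evR_inj
    intro m
    rw [evR_eval₂, evR_eval₂]
    have h1 := hpf (g ^ m) (hgm m) (i, j)
    rw [hfgm m, hpm (two ^ m) (i, j)] at h1
    convert h1.symm using 2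
    · congr 1
      funext q
      rcases q with q | q
      · have := congrFun (congrFun (hMnat m) q.1) q.2
        exact this
      · simp only [vM, Sum.elim_inr, evR_single]
        have : ((((g ^ m)⁻¹ : GL (Fin G.n) k)) : Matrix (Fin G.n) (Fin G.n) k).det =
            ((Matrix.GeneralLinearGroup.det ((g ^ m)⁻¹) : kˣ) : k) := rfl
        rw [this, map_inv (Matrix.GeneralLinearGroup.det (n := Fin G.n) (R := k)), map_pow]
        simp [chiN, δ]
    · congr 1
      funext b
      cases b <;> simp [vT, evR_single, chiN, τ]
  have key2 := congrArg (evR 0 (θ t)) key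
  rw [evR_eval₂, evR_eval₂] at key2
  have hθτ : θ t τ = ((t ^ N : kˣ) : k) := by
    simp [θ, τ, hφ]
  have hθτ' : θ t τ⁻¹ = (((t ^ N)⁻¹ : kˣ) : k) := by
    simp [θ, τ, hφ]
  have h3 := hpf _ (hlamG t) (i, j)
  have h4 := hpm (t ^ N) (i, j)
  rw [map_pow] at h4
  change (f.toFun (diagHom P e t) : Matrix (Fin G'.n) (Fin G'.n) k) i j = _
  refine h3.trans (Eq.trans ?_ (key2.trans (Eq.trans ?_ h4.symm)))
  · congr 2
    funext q
    rcases q with q | q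
    · have := congrFun (congrFun (hMzero t) q.1) q.2
      exact this.symm
    · simp only [vM, Sum.elim_inr, evR_single]
      have h5 : (((diagHom P e t)⁻¹ : GL (Fin G.n) k) : Matrix (Fin G.n) (Fin G.n) k).det =
          ((Matrix.GeneralLinearGroup.det ((diagHom P e t)⁻¹) : kˣ) : k) := rfl
      have h6 := congrArg (evR 0 (θ t)) hdet
      rw [RingHom.map_det, hMzero, evR_single] at h6
      have h7 : ((Matrix.GeneralLinearGroup.det (diagHom P e t) : kˣ) : k) =
        ((zpowersHom kˣ t (φ δ) : kˣ) : k) := by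
        refine Eq.trans h6 ?_
        simp [θ]
      rw [h5, map_inv (Matrix.GeneralLinearGroup.det (n := Fin G.n) (R := k)), Units.ext h7]
      simp [θ]
  · congr 2
    funext b
    cases b
    · simp [vT, evR_single, hθτ']
    · simp [vT, evR_single, hθτ]

end PaperGIT
end
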